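/- arXiv:1207.2752 — 3 statements merged into one kernel-verified Lean document; each statement's English description precedes it below -/
import Mathlib

section
/- Let n ≥ 3, t ≥ 2, and let j : Fin t → ℤ satisfy j s ≢ 0 (mod n) and 2·(j s) ≢ 0 (mod n) for all s, and suppose X = GI(n;j) is connected. If some automorphism of X maps a spoke edge to a layer edge (equivalently, fails to respect the fundamental edge-partition), then X is isomorphic to one of the eight special GI-graphs GI(4;1,1), GI(5;1,2), GI(8;1,3), GI(10;1,2), GI(10;1,3), GI(12;1,5), GI(24;1,5), GI(3;1,1,1). -/
open SimpleGraph

/-- The GI-graph `GI(n; j)` on vertex set `Fin t × ZMod n`: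
`(s,v)` and `(s',v')` are adjacent iff `v = v'` and `s ≠ s'` (a spoke edge), or
`s = s'` and `v' = v + j s` or `v' = v - j s` in `ZMod n` (a layer edge). -/
def GI (n t : ℕ) (j : Fin t → ℤ) : SimpleGraph (Fin t × ZMod n) :=
  SimpleGraph.fromRel (fun x y =>
    (x.2 = y.2 ∧ x.1 ≠ y.1) ∨ (x.1 = y.1 ∧ y.2 = x.2 + (j x.1 : ZMod n)))

/-- A map on vertices respects the fundamental edge-partition of `GI(n;j)` if it maps
spoke edges to spoke edges and layer edges to layer edges. -/
def RespectsPart (n t : ℕ) (j : Fin t → ℤ) (f : Fin t × ZMod n → Fin t × ZMod n) : Prop :=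
  (∀ x y : Fin t × ZMod n, (GI n t j).Adj x y → x.2 = y.2 → (f x).2 = (f y).2) ∧
  (∀ x y : Fin t × ZMod n, (GI n t j).Adj x y → x.1 = y.1 → (f x).1 = (f y).1)

/-- The `k`-fold concatenation `[k]j` of the sequence `j`. -/
def rep (k t : ℕ) (j : Fin t → ℤ) : Fin (k * t) → ℤ :=
  fun s => j ⟨(s : ℕ) % t, Nat.mod_lt _ (by
    rcases Nat.eq_zero_or_pos t with ht | ht
    · exact absurd s.isLt (by simp [ht])
    · exact ht)⟩

/-- The sequence `j` is primitive (mod `n`): some `j s ≡ 1 (mod n)` and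
`j i ≢ ±j k (mod n)` whenever `i ≠ k`. -/
def PrimitiveSeq (n : ℕ) {t : ℕ} (j : Fin t → ℤ) : Prop :=
  (∃ s, (j s : ZMod n) = 1) ∧
  ∀ i k : Fin t, i ≠ k →
    (j i : ZMod n) ≠ (j k : ZMod n) ∧ (j i : ZMod n) ≠ -(j k : ZMod n)

/-- The set `J = {j s mod n : s}`. -/
def Jset (n : ℕ) {t : ℕ} (j : Fin t → ℤ) : Set (ZMod n) :=
  Set.range (fun s => ((j s : ZMod n)))

/-- The set `J ∪ -J`. -/
def JJset (n : ℕ) {t : ℕ} (j : Fin t → ℤ) : Set (ZMod n) :=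
  Jset n j ∪ (Neg.neg '' Jset n j)

/-- A graph is vertex-transitive if its automorphism group acts transitively on vertices. -/
def IsVertexTransitive {V : Type*} (G : SimpleGraph V) : Prop :=
  ∀ x y : V, ∃ φ : G ≃g G, φ x = y

/-- `H` is a group of automorphisms of `G` acting simply transitively (regularly)
on the vertices. -/
def IsRegularAutGroup {V : Type*} (G : SimpleGraph V) (H : Subgroup (Equiv.Perm V)) : Prop :=
  (∀ π ∈ H, ∀ x y : V, G.Adj x y ↔ G.Adj (π x) (π y)) ∧
  ∀ x y : V, ∃! π : Equiv.Perm V, π ∈ H ∧ π x = y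

/-- A graph is a Cayley graph iff its automorphism group has a subgroup acting
simply transitively (regularly) on the vertices. -/
def IsCayley {V : Type*} (G : SimpleGraph V) : Prop :=
  ∃ H : Subgroup (Equiv.Perm V), IsRegularAutGroup G H

/-- The standard rotation `ρ : (s,v) ↦ (s, v+1)` as a permutation of the vertices. -/
def rho (n t : ℕ) : Equiv.Perm (Fin t × ZMod n) :=
  Equiv.prodCongr (Equiv.refl (Fin t)) (Equiv.addRight (1 : ZMod n))

/-- The map `λ_{i,s₁,s₂}`, which swaps `(s₁,v)` and `(s₂,v)` whenever
`v ≡ i (mod gcd(n, j s₁))` (i.e. the image of `v` under the natural map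
`ZMod n → ZMod (gcd (n, j s₁))` equals `i mod gcd(n, j s₁)`), and fixes all other
vertices. -/
def lamMap (n t : ℕ) (j : Fin t → ℤ) (s₁ s₂ : Fin t) (i : ℤ) (x : Fin t × ZMod n) :
    Fin t × ZMod n :=
  if (ZMod.cast x.2 : ZMod (Int.gcd (n : ℤ) (j s₁))) =
      ((i : ℤ) : ZMod (Int.gcd (n : ℤ) (j s₁))) then
    if x.1 = s₁ then (s₂, x.2) else if x.1 = s₂ then (s₁, x.2) else x
  else x

section NonBacktracking

variable {D : Type*} [Fintype D] [DecidableEq D]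

/-- The number of `R`-walks with `m` steps from `d` to `e`. -/
def walkCount (R : D → D → Prop) [DecidableRel R] : ℕ → D → D → ℕ
  | 0, d, e => if d = e then 1 else 0
  | m + 1, d, e => ∑ c, if R d c then walkCount R m c e else 0

theorem walkCount_equiv (R : D → D → Prop) [DecidableRel R] (Φ : D ≃ D)
    (hΦ : ∀ d e, R (Φ d) (Φ e) ↔ R d e) (m : ℕ) (d e : D) :
    walkCount R m (Φ d) (Φ e) = walkCount R m d e := by
  induction m generalizing d with
  | zero => simp [walkCount]
  | succ m ih =>
    simp only [walkCount]
    rw [← Equiv.sum_comp Φ]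
    simp only [hΦ, ih]

end NonBacktracking

namespace GI

section General

variable {n t : ℕ} {j : Fin t → ℤ}

theorem adj_iff (hj : ∀ s, (j s : ZMod n) ≠ 0) (x y : Fin t × ZMod n) :
    (GI n t j).Adj x y ↔ (x.2 = y.2 ∧ x.1 ≠ y.1) ∨
      (x.1 = y.1 ∧ (y.2 = x.2 + j x.1 ∨ y.2 = x.2 - j x.1)) := by
  obtain ⟨s, v⟩ := x
  obtain ⟨r, w⟩ := y
  simp only [GI, SimpleGraph.fromRel_adj, ne_eq, Prod.mk.injEq]
  constructor
  · rintro ⟨-, (h | ⟨rfl, h⟩) | (⟨rfl, h⟩ | ⟨rfl, h⟩)⟩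
    · exact Or.inl h
    · exact Or.inr ⟨rfl, Or.inl h⟩
    · exact Or.inl ⟨rfl, fun h' => h h'.symm⟩
    · exact Or.inr ⟨rfl, Or.inr (by rw [h]; ring)⟩
  · rintro (⟨rfl, h⟩ | ⟨rfl, h | h⟩)
    · exact ⟨fun h' => h h'.1, Or.inl (Or.inl ⟨rfl, h⟩)⟩
    · refine ⟨fun h' => hj s ?_, Or.inl (Or.inr ⟨rfl, h⟩)⟩
      rw [← h'.2] at h
      exact left_eq_add.1 h
    · refine ⟨fun h' => hj s ?_, Or.inr (Or.inr ⟨rfl, by rw [h]; ring⟩)⟩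
      rw [← h'.2] at h
      exact sub_eq_self.1 h.symm

/-- Multiplying all the layer parameters by a common unit, permuting them and changing signs
does not change the GI-graph up to isomorphism. -/
theorem nonempty_iso_of_unit {j' : Fin t → ℤ} (u : (ZMod n)ˣ) (σ : Fin t ≃ Fin t)
    (h : ∀ s, (j' (σ s) : ZMod n) = u * j s ∨ (j' (σ s) : ZMod n) = -(u * j s)) :
    Nonempty (GI n t j ≃g GI n t j') := by
  refine ⟨⟨Equiv.prodCongr σ (Units.mulLeft u), ?_⟩⟩
  have key : ∀ (s : Fin t) (v w : ZMod n),
      ((u : ZMod n) * w = u * v + j' (σ s) ∨ (u : ZMod n) * v = u * w + j' (σ s)) ↔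
        (w = v + j s ∨ v = w + j s) := by
    intro s v w
    have e1 : ∀ x y z : ZMod n, (u : ZMod n) * x = u * y + u * z ↔ x = y + z := by
      intro x y z
      rw [← mul_add, Units.mul_right_inj]
    rcases h s with h | h <;> rw [h]
    · rw [e1, e1]
    · have e2 : ∀ x y z : ZMod n, (u : ZMod n) * x = u * y + -(u * z) ↔ y = x + z := by
        intro x y z
        rw [← e1 y x z]
        constructor <;> intro h <;> rw [h] <;> ring
      rw [e2, e2, or_comm]
  rintro ⟨s, v⟩ ⟨r, w⟩
  simp only [GI, SimpleGraph.fromRel_adj, Equiv.prodCongr_apply, Prod.map_apply, ne_eq,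
    Prod.mk.injEq, EmbeddingLike.apply_eq_iff_eq, Units.mulLeft_apply, Units.mul_right_inj]
  by_cases hs : s = r
  · subst hs
    have := key s v w
    tauto
  · have hr : ¬ r = s := fun h => hs h.symm
    simp [hs, hr]

/-- In a connected GI-graph the layer parameters generate `ZMod n`. -/
theorem intCast_eq_zero_of_connected (hj : ∀ s, (j s : ZMod n) ≠ 0)
    (hconn : (GI n t j).Connected) {m : ℤ} (hm : ∀ s, (m : ZMod n) * j s = 0) :
    (m : ZMod n) = 0 := by
  have step : ∀ x y, (GI n t j).Adj x y → (m : ZMod n) * x.2 = m * y.2 := by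
    intro x y h
    rcases (adj_iff hj x y).1 h with ⟨h, -⟩ | ⟨-, h | h⟩
    · rw [h]
    · rw [h, mul_add, hm, add_zero]
    · rw [h, mul_sub, hm, sub_zero]
  have walk : ∀ x y, (GI n t j).Reachable x y → (m : ZMod n) * x.2 = m * y.2 := by
    rintro x y ⟨p⟩
    induction p with
    | nil => rfl
    | cons h _ ih => exact (step _ _ h).trans ih
  obtain ⟨⟨s, -⟩⟩ := hconn.nonempty
  simpa using (walk (s, 0) (s, 1) (hconn.preconnected _ _)).symm

theorem sub_eq_of_layer_triangle {n : ℕ} {a u v w : ZMod n} (h2 : 2 * a ≠ 0) (hvw : v ≠ w)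
    (huv : v = u + a ∨ v = u - a) (huw : w = u + a ∨ w = u - a)
    (h : w = v + a ∨ w = v - a) : 3 * a = 0 := by
  rcases huv with rfl | rfl <;> rcases huw with rfl | rfl
  · exact absurd rfl hvw
  · rcases h with h | h
    · linear_combination -h
    · exact absurd (by linear_combination -h) (show a ≠ 0 by rintro rfl; simp at h2)
  · rcases h with h | h
    · exact absurd (by linear_combination h) (show a ≠ 0 by rintro rfl; simp at h2)
    · linear_combination h
  · exact absurd rfl hvw

end General

end GI
namespace GI

section Triangles

variable {n t : ℕ} {j : Fin t → ℤ}

theorem fst_eq_of_triangle (hj : ∀ s, (j s : ZMod n) ≠ 0) {x y z : Fin t × ZMod n}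
    (hxy : (GI n t j).Adj x y) (hxz : (GI n t j).Adj x z) (hyz : (GI n t j).Adj y z)
    (h : x.2 ≠ y.2) : y.1 = x.1 ∧ z.1 = x.1 := by
  rw [adj_iff hj] at hxy hxz hyz
  rcases hxy with ⟨h', -⟩ | ⟨hxy, -⟩
  · exact absurd h' h
  refine ⟨hxy.symm, ?_⟩
  rcases hxz with ⟨hxz, hne⟩ | ⟨hxz, -⟩
  · rcases hyz with ⟨hyz, -⟩ | ⟨hyz, -⟩
    · exact absurd (hxz.trans hyz.symm) h
    · exact absurd (hxy.trans hyz) hne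
  · exact hxz.symm

/-- A skew automorphism maps some column of a GI-graph into a layer. -/
theorem exists_column_to_layer (hj : ∀ s, (j s : ZMod n) ≠ 0) (φ : GI n t j ≃g GI n t j)
    {x y : Fin t × ZMod n} (hxy : (GI n t j).Adj x y) (h : x.2 = y.2)
    (hφ : (φ x).2 ≠ (φ y).2) (r : Fin t) : (φ (r, x.2)).1 = (φ x).1 := by
  have hadj : ∀ z : Fin t × ZMod n, z.2 = x.2 → z.1 ≠ r → (GI n t j).Adj z (r, x.2) :=
    fun z hz hr => (adj_iff hj _ _).2 (Or.inl ⟨hz, hr⟩)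
  have hφxy := φ.map_adj_iff.2 hxy
  have hlayer : (φ x).1 = (φ y).1 := by
    rcases (adj_iff hj _ _).1 hφxy with ⟨h', -⟩ | ⟨h', -⟩
    · exact absurd h' hφ
    · exact h'
  by_cases hx : x.1 = r
  · rw [← hx]
  by_cases hy : y.1 = r
  · rw [← hy, h, hlayer]
  · exact (fst_eq_of_triangle hj hφxy (φ.map_adj_iff.2 (hadj x rfl hx))
      (φ.map_adj_iff.2 (hadj y h.symm hy)) hφ).2

theorem exists_ne_ne_of_three_le (ht : 3 ≤ t) (l : Fin t) :
    ∃ p q : Fin t, p ≠ l ∧ q ≠ l ∧ p ≠ q := by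
  have : 1 < (Finset.univ.erase l).card := by simp; omega
  obtain ⟨p, hp, q, hq, hpq⟩ := Finset.one_lt_card.1 this
  exact ⟨p, q, Finset.ne_of_mem_erase hp, Finset.ne_of_mem_erase hq, hpq⟩

theorem three_mul_eq_zero_of_skew (ht : 3 ≤ t)
    (hj : ∀ s, (j s : ZMod n) ≠ 0) (hj2 : ∀ s, 2 * (j s : ZMod n) ≠ 0)
    (φ : GI n t j ≃g GI n t j)
    {x y : Fin t × ZMod n} (hxy : (GI n t j).Adj x y) (h : x.2 = y.2)
    (hφ : (φ x).2 ≠ (φ y).2) (r : Fin t) : 3 * (j r : ZMod n) = 0 := by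
  have hcol := exists_column_to_layer hj φ hxy h hφ
  obtain ⟨p, q, hp, hq, hpq⟩ := exists_ne_ne_of_three_le ht (φ x).1
  set w := (φ (r, x.2)).2 with hw
  have hXw : φ (r, x.2) = ((φ x).1, w) := Prod.ext (hcol r) rfl
  have hX : ∀ p, p ≠ (φ x).1 → (GI n t j).Adj (r, x.2) (φ.symm (p, w)) ∧
      (φ.symm (p, w)).2 ≠ x.2 := by
    intro p hp
    constructor
    · rw [← φ.map_adj_iff, φ.apply_symm_apply, hXw, adj_iff hj]
      exact Or.inl ⟨rfl, hp.symm⟩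
    · intro h'
      have h1 := hcol (φ.symm (p, w)).1
      rw [← h', Prod.mk.eta, φ.apply_symm_apply] at h1
      exact hp h1
  have hPQ : (GI n t j).Adj (φ.symm (p, w)) (φ.symm (q, w)) := by
    rw [φ.symm.map_adj_iff, adj_iff hj]
    exact Or.inl ⟨rfl, hpq⟩
  obtain ⟨hP, hP'⟩ := hX p hp
  obtain ⟨hQ, hQ'⟩ := hX q hq
  generalize φ.symm (p, w) = P at *
  generalize φ.symm (q, w) = Q at *
  rw [adj_iff hj] at hP hQ hPQ
  obtain ⟨P1, P2⟩ := P
  obtain ⟨Q1, Q2⟩ := Q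
  rcases hP with ⟨hP, -⟩ | ⟨hP1, hP⟩
  · exact absurd hP.symm hP'
  rcases hQ with ⟨hQ, -⟩ | ⟨hQ1, hQ⟩
  · exact absurd hQ.symm hQ'
  dsimp only at *
  subst hP1 hQ1
  rcases hPQ with ⟨-, hPQ⟩ | ⟨-, hPQ⟩
  · exact absurd rfl hPQ
  refine sub_eq_of_layer_triangle (hj2 r) ?_ hP hQ hPQ
  rintro rfl
  rcases hPQ with h' | h'
  · exact hj r (left_eq_add.1 h')
  · exact hj r (sub_eq_self.1 h'.symm)

theorem eq_three_of_skew (hn : 3 ≤ n) (ht : 3 ≤ t)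
    (hj : ∀ s, (j s : ZMod n) ≠ 0) (hj2 : ∀ s, 2 * (j s : ZMod n) ≠ 0)
    (hconn : (GI n t j).Connected) (φ : GI n t j ≃g GI n t j)
    {x y : Fin t × ZMod n} (hxy : (GI n t j).Adj x y) (h : x.2 = y.2)
    (hφ : (φ x).2 ≠ (φ y).2) : n = 3 ∧ t = 3 := by
  have h3 : ((3 : ℤ) : ZMod n) = 0 := intCast_eq_zero_of_connected hj hconn fun s => by
    simpa using three_mul_eq_zero_of_skew ht hj hj2 φ hxy h hφ s
  have hn3 : n = 3 := by
    have hdvd := (ZMod.intCast_zmod_eq_zero_iff_dvd 3 n).1 h3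
    have := Nat.le_of_dvd (by norm_num) (show n ∣ 3 by exact_mod_cast hdvd)
    omega
  refine ⟨hn3, ?_⟩
  have hinj : Function.Injective fun r : Fin t => (φ (r, x.2)).2 := by
    intro r s hrs
    have hcol := exists_column_to_layer hj φ hxy h hφ
    have := φ.injective (Prod.ext ((hcol r).trans (hcol s).symm) hrs)
    exact congrArg Prod.fst this
  have : NeZero n := ⟨by omega⟩
  have hcard := Fintype.card_le_of_injective _ hinj
  rw [Fintype.card_fin, ZMod.card] at hcard
  omega

theorem nonempty_iso_three {j : Fin 3 → ℤ} (hj : ∀ s, (j s : ZMod 3) ≠ 0) :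
    Nonempty (GI 3 3 j ≃g GI 3 3 ![1, 1, 1]) := by
  refine nonempty_iso_of_unit 1 (Equiv.refl _) fun s => ?_
  have h1 : ((![1, 1, 1] : Fin 3 → ℤ) s : ZMod 3) = 1 := by fin_cases s <;> rfl
  have : ∀ a : ZMod 3, a ≠ 0 → 1 = a ∨ 1 = -a := by decide
  simpa [h1] using this _ (hj s)

end Triangles

end GI
namespace GI

/-- A dart of an I-graph: its initial vertex and its direction, where `0` stands for the spoke
and `1`, `-1` stand for the two layer edges. -/
abbrev IDart (n : ℕ) : Type := (Fin 2 × ZMod n) × SignType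

/-- The layer reached from layer `s` in the direction `e`. -/
def turn (s : Fin 2) (e : SignType) : Fin 2 := if e = 0 then s + 1 else s

/-- The voltage of the dart from layer `s` in the direction `e`, as a pair of coefficients of the
two layer parameters. -/
def voltage (s : Fin 2) (e : SignType) : ℤ × ℤ := if s = 0 then (e, 0) else (0, e)

/-- The value of a formal voltage when the layer parameters are `a` and `b`. -/
def evalVoltage {R : Type*} [Ring R] (a b : R) (p : ℤ × ℤ) : R := p.1 * a + p.2 * b

/-- The terminal vertex of a dart. -/
def endpoint {n : ℕ} (a b : ZMod n) (d : IDart n) : Fin 2 × ZMod n :=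
  (turn d.1.1 d.2, d.1.2 + evalVoltage a b (voltage d.1.1 d.2))

/-- The dart `d'` follows `d` on a non-backtracking walk. -/
def Follows {n : ℕ} (a b : ZMod n) (d d' : IDart n) : Prop :=
  d'.1 = endpoint a b d ∧ d'.2 ≠ -d.2

instance {n : ℕ} (a b : ZMod n) : DecidableRel (Follows a b) :=
  fun _ _ => inferInstanceAs (Decidable (_ ∧ _))

/-- The kind of an edge: `none` for a spoke, `some s` for an edge in layer `s`. -/
def edgeKind (s : Fin 2) (e : SignType) : Option (Fin 2) := if e = 0 then none else some s

/-- The final layers, directions and voltages of the non-backtracking walks with `m` steps that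
start from a dart in layer `s` with direction `e` and voltage `p`. -/
def walkEnds : ℕ → Fin 2 → SignType → ℤ × ℤ → List ((Fin 2 × SignType) × (ℤ × ℤ))
  | 0, s, e, p => [((s, e), p)]
  | m + 1, s, e, p => ([0, 1, -1].filter (fun f : SignType => f ≠ -e)).flatMap
      fun f => walkEnds m (turn s e) f (p.1 + (voltage s e).1, p.2 + (voltage s e).2)

section Counting

variable {n : ℕ} [NeZero n] (a b : ZMod n)

theorem walkCount_eq_countP (m : ℕ) (s s' : Fin 2) (e e' : SignType) (v : ZMod n) (p : ℤ × ℤ) :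
    walkCount (Follows a b) m ((s, v + evalVoltage a b p), e) ((s', v), e') =
      (walkEnds m s e p).countP (fun x => x.1 = (s', e') ∧ evalVoltage a b x.2 = 0) := by
  induction m generalizing s e p with
  | zero =>
    simp only [walkCount, walkEnds, List.countP_singleton, Prod.mk.injEq, add_eq_left,
      decide_eq_true_eq]
    congr 1
    simp only [eq_iff_iff]
    tauto
  | succ m ih =>
    have hsum : ∀ g : SignType → ℕ, ∑ f, (if f ≠ -e then g f else 0) =
        (([0, 1, -1].filter (fun f : SignType => f ≠ -e)).map g).sum := by
      intro g
      have hu : (Finset.univ : Finset SignType) = {0, 1, -1} := by decide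
      rw [hu]
      cases e <;> simp [Finset.sum_insert]
    simp only [walkCount, walkEnds]
    rw [List.countP_flatMap, Fintype.sum_prod_type,
      Finset.sum_eq_single (endpoint a b ((s, v + evalVoltage a b p), e))]
    · simp only [Follows, true_and]
      rw [hsum]
      congr 2
      funext f
      rw [Function.comp_apply, ← ih]
      congr 3
      simp only [endpoint, evalVoltage, Prod.mk.injEq, true_and]
      push_cast
      ring
    · intro x _ hx
      simp [Follows, hx]
    · simp

theorem walkCount_self (m : ℕ) (d : IDart n) :
    walkCount (Follows a b) m d d = (walkEnds m d.1.1 d.2 (0, 0)).countP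
      (fun x => x.1 = (d.1.1, d.2) ∧ evalVoltage a b x.2 = 0) := by
  have := walkCount_eq_countP a b m d.1.1 d.1.1 d.2 d.2 d.1.2 (0, 0)
  simpa [evalVoltage] using this

end Counting

/-- A pair of coefficients up to sign. -/
def signNormal (p : ℤ × ℤ) : ℤ × ℤ := if p.1 < 0 ∨ p.1 = 0 ∧ p.2 < 0 then (-p.1, -p.2) else p

theorem evalVoltage_signNormal {R : Type*} [Ring R] (a b : R) (p : ℤ × ℤ) :
    evalVoltage a b (signNormal p) = 0 ↔ evalVoltage a b p = 0 := by
  unfold signNormal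
  split_ifs
  · rw [← neg_eq_zero, evalVoltage, evalVoltage]
    simp [add_comm]
  · rfl

/-- The voltages, with multiplicities and up to sign, of the closed non-backtracking walks with
`8` steps through an edge of the given kind. -/
def octagons : Option (Fin 2) → List (ℕ × (ℤ × ℤ))
  | none => [(4, 0, 0), (4, 0, 2), (2, 1, -5), (2, 1, 5), (2, 2, -4), (2, 2, -2), (4, 2, 0),
      (2, 2, 2), (2, 2, 4), (2, 3, -3), (2, 3, 3), (2, 4, -2), (2, 4, 2), (2, 5, -1), (2, 5, 1)]
  | some 0 => [(2, 0, 0), (2, 0, 2), (1, 1, -5), (1, 1, 5), (2, 2, -4), (1, 2, -2), (2, 2, 0),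
      (1, 2, 2), (2, 2, 4), (3, 3, -3), (3, 3, 3), (4, 4, -2), (4, 4, 2), (5, 5, -1), (5, 5, 1),
      (1, 8, 0)]
  | some 1 => [(2, 0, 0), (2, 0, 2), (1, 0, 8), (5, 1, -5), (5, 1, 5), (4, 2, -4), (1, 2, -2),
      (2, 2, 0), (1, 2, 2), (4, 2, 4), (3, 3, -3), (3, 3, 3), (2, 4, -2), (2, 4, 2), (1, 5, -1),
      (1, 5, 1)]

/-- The voltages, with multiplicities and up to sign, of the closed non-backtracking walks with
`10` steps through an edge of the given kind. -/
def decagons : Option (Fin 2) → List (ℕ × (ℤ × ℤ))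
  | none => [(8, 0, 0), (12, 0, 2), (12, 0, 4), (2, 1, -7), (8, 1, -3), (8, 1, -1), (8, 1, 1),
      (8, 1, 3), (2, 1, 7), (2, 2, -6), (6, 2, -4), (8, 2, -2), (12, 2, 0), (8, 2, 2), (6, 2, 4),
      (2, 2, 6), (2, 3, -5), (8, 3, -3), (8, 3, -1), (8, 3, 1), (8, 3, 3), (2, 3, 5), (2, 4, -4),
      (6, 4, -2), (12, 4, 0), (6, 4, 2), (2, 4, 4), (2, 5, -3), (2, 5, 3), (2, 6, -2), (2, 6, 2),
      (2, 7, -1), (2, 7, 1)]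
  | some 0 => [(6, 0, 0), (8, 0, 2), (6, 0, 4), (1, 1, -7), (6, 1, -3), (6, 1, -1), (6, 1, 1),
      (6, 1, 3), (1, 1, 7), (2, 2, -6), (3, 2, -4), (6, 2, -2), (10, 2, 0), (6, 2, 2), (3, 2, 4),
      (2, 2, 6), (3, 3, -5), (6, 3, -3), (6, 3, -1), (6, 3, 1), (6, 3, 3), (3, 3, 5), (4, 4, -4),
      (6, 4, -2), (12, 4, 0), (6, 4, 2), (4, 4, 4), (5, 5, -3), (5, 5, 3), (6, 6, -2), (6, 6, 2),
      (7, 7, -1), (7, 7, 1), (1, 10, 0)]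
  | some 1 => [(6, 0, 0), (10, 0, 2), (12, 0, 4), (1, 0, 10), (7, 1, -7), (6, 1, -3), (6, 1, -1),
      (6, 1, 1), (6, 1, 3), (7, 1, 7), (6, 2, -6), (6, 2, -4), (6, 2, -2), (8, 2, 0), (6, 2, 2),
      (6, 2, 4), (6, 2, 6), (5, 3, -5), (6, 3, -3), (6, 3, -1), (6, 3, 1), (6, 3, 3), (5, 3, 5),
      (4, 4, -4), (3, 4, -2), (6, 4, 0), (3, 4, 2), (4, 4, 4), (3, 5, -3), (3, 5, 3), (2, 6, -2),
      (2, 6, 2), (1, 7, -1), (1, 7, 1)]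

/-- The total multiplicity of the voltages in `l` that satisfy `P`. -/
def tally (P : ℤ × ℤ → Prop) [DecidablePred P] (l : List (ℕ × (ℤ × ℤ))) : ℕ :=
  (l.map fun x => x.1 * if P x.2 then 1 else 0).sum

theorem countP_flatMap_replicate (P : ℤ × ℤ → Prop) [DecidablePred P]
    (l : List (ℕ × (ℤ × ℤ))) :
    (l.flatMap fun x => List.replicate x.1 x.2).countP P = tally P l := by
  simp only [List.countP_flatMap, tally]
  congr 2
  funext x
  simp [List.countP_replicate]

theorem walkEnds_eight_perm : ∀ (s : Fin 2) (e : SignType),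
    List.isPerm ((((walkEnds 8 s e (0, 0)).filter fun x => x.1 = (s, e)).map
      fun x => signNormal x.2)) ((octagons (edgeKind s e)).flatMap
      fun x => List.replicate x.1 x.2) = true := by
  decide +kernel

theorem walkEnds_ten_perm : ∀ (s : Fin 2) (e : SignType),
    List.isPerm ((((walkEnds 10 s e (0, 0)).filter fun x => x.1 = (s, e)).map
      fun x => signNormal x.2)) ((decagons (edgeKind s e)).flatMap
      fun x => List.replicate x.1 x.2) = true := by
  decide +kernel

theorem walkCount_self_eq_tally {n : ℕ} [NeZero n] (a b : ZMod n) {m : ℕ}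
    {l : Option (Fin 2) → List (ℕ × (ℤ × ℤ))}
    (hl : ∀ (s : Fin 2) (e : SignType),
      List.isPerm ((((walkEnds m s e (0, 0)).filter fun x => x.1 = (s, e)).map
        fun x => signNormal x.2)) ((l (edgeKind s e)).flatMap
        fun x => List.replicate x.1 x.2) = true) (d : IDart n) :
    walkCount (Follows a b) m d d =
      tally (fun p => evalVoltage a b p = 0) (l (edgeKind d.1.1 d.2)) := by
  rw [walkCount_self, ← countP_flatMap_replicate,
    ← (List.isPerm_iff.1 (hl d.1.1 d.2)).countP_eq, List.countP_map, List.countP_filter]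
  congr 1
  funext x
  simp [evalVoltage_signNormal, and_comm]

end GI
namespace GI

section Skew

variable {n : ℕ} {j : Fin 2 → ℤ}

theorem evalVoltage_voltage (s : Fin 2) (e : SignType) :
    evalVoltage (j 0 : ZMod n) (j 1) (voltage s e) = (e : ZMod n) * j s := by
  fin_cases s <;> simp [evalVoltage, voltage]

theorem endpoint_eq (d : IDart n) :
    endpoint (j 0 : ZMod n) (j 1) d = (turn d.1.1 d.2, d.1.2 + (d.2 : ZMod n) * j d.1.1) := by
  rw [endpoint, evalVoltage_voltage]

theorem adj_endpoint (hj : ∀ s, (j s : ZMod n) ≠ 0) (d : IDart n) :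
    (GI n 2 j).Adj d.1 (endpoint (j 0 : ZMod n) (j 1) d) := by
  obtain ⟨⟨s, v⟩, e⟩ := d
  rw [endpoint_eq, adj_iff hj]
  have hs : s ≠ s + 1 := by revert s; decide
  cases e <;> simp [turn, hs, sub_eq_add_neg]

theorem exists_endpoint_eq (hj : ∀ s, (j s : ZMod n) ≠ 0) {x y : Fin 2 × ZMod n}
    (h : (GI n 2 j).Adj x y) : ∃ e, endpoint (j 0 : ZMod n) (j 1) (x, e) = y := by
  obtain ⟨s, v⟩ := x
  obtain ⟨r, w⟩ := y
  simp only [endpoint_eq]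
  rcases (adj_iff hj _ _).1 h with ⟨h1, h2⟩ | ⟨h1, h2⟩ <;> dsimp only at h1 h2
  · refine ⟨0, ?_⟩
    have h3 : ∀ s r : Fin 2, s ≠ r → s + 1 = r := by decide
    have := h3 s r h2
    simp [turn, this, h1]
  · subst h1
    rcases h2 with rfl | rfl
    · exact ⟨1, by simp [turn]⟩
    · exact ⟨-1, by simp [turn, sub_eq_add_neg]⟩

theorem endpoint_injective (hj : ∀ s, (j s : ZMod n) ≠ 0) (hj2 : ∀ s, 2 * (j s : ZMod n) ≠ 0)
    (x : Fin 2 × ZMod n) :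
    Function.Injective fun e => endpoint (j 0 : ZMod n) (j 1) (x, e) := by
  obtain ⟨s, v⟩ := x
  intro e f h
  simp only [endpoint_eq, Prod.mk.injEq, add_right_inj] at h
  obtain ⟨-, h⟩ := h
  have h1 := hj s
  have h2 := hj2 s
  have h3 : (j s : ZMod n) ≠ -j s := fun h => h2 (by linear_combination h)
  cases e <;> cases f <;> simp_all [eq_comm]

theorem endpoint_endpoint_neg (d : IDart n) :
    endpoint (j 0 : ZMod n) (j 1) (endpoint (j 0 : ZMod n) (j 1) d, -d.2) = d.1 := by
  obtain ⟨⟨s, v⟩, e⟩ := d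
  simp only [endpoint_eq]
  have hs : s + 1 + 1 = s := by revert s; decide
  cases e <;> simp [turn, hs]

theorem follows_iff (hj : ∀ s, (j s : ZMod n) ≠ 0) (hj2 : ∀ s, 2 * (j s : ZMod n) ≠ 0)
    (d d' : IDart n) : Follows (j 0 : ZMod n) (j 1) d d' ↔
      d'.1 = endpoint (j 0 : ZMod n) (j 1) d ∧ endpoint (j 0 : ZMod n) (j 1) d' ≠ d.1 := by
  refine and_congr_right fun h => not_congr ?_
  obtain ⟨x, e⟩ := d'
  dsimp only at h ⊢
  subst h
  rw [← (endpoint_injective hj hj2 _).eq_iff, endpoint_endpoint_neg]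

/-- An automorphism of an I-graph acts on the darts, and preserves `Follows`. -/
theorem exists_dartEquiv [NeZero n] (hj : ∀ s, (j s : ZMod n) ≠ 0)
    (hj2 : ∀ s, 2 * (j s : ZMod n) ≠ 0) (φ : GI n 2 j ≃g GI n 2 j) :
    ∃ Φ : IDart n ≃ IDart n, (∀ d, (Φ d).1 = φ d.1) ∧
      (∀ d, endpoint (j 0 : ZMod n) (j 1) (Φ d) = φ (endpoint (j 0 : ZMod n) (j 1) d)) ∧
      ∀ d e, Follows (j 0 : ZMod n) (j 1) (Φ d) (Φ e) ↔ Follows (j 0 : ZMod n) (j 1) d e := by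
  have hex : ∀ d : IDart n, ∃ e, endpoint (j 0 : ZMod n) (j 1) (φ d.1, e) =
      φ (endpoint (j 0 : ZMod n) (j 1) d) := fun d =>
    exists_endpoint_eq hj (φ.map_adj_iff.2 (adj_endpoint hj d))
  choose E hE using hex
  have hinj : Function.Injective fun d : IDart n => ((φ d.1, E d) : IDart n) := by
    rintro ⟨x, e⟩ ⟨y, f⟩ h
    obtain ⟨h1, h2⟩ := Prod.mk.inj h
    have hxy : x = y := φ.injective h1
    subst hxy
    have h3 := hE (x, e)
    dsimp only at h1 h2 h3
    rw [h2] at h3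
    have h4 := φ.injective (h3.symm.trans (hE (x, f)))
    rw [endpoint_injective hj hj2 x h4]
  refine ⟨Equiv.ofBijective _ (Finite.injective_iff_bijective.1 hinj), fun d => rfl, hE, ?_⟩
  intro d d'
  rw [follows_iff hj hj2, follows_iff hj hj2]
  simp only [Equiv.ofBijective_apply, hE, ne_eq, φ.injective.eq_iff]

/-- An automorphism of an I-graph that maps some spoke edge to a layer edge maps, for each of the
three kinds of edges, some edge of that kind to an edge of another kind. -/
theorem exists_edgeKind_ne [NeZero n] (hj : ∀ s, (j s : ZMod n) ≠ 0)
    (φ : GI n 2 j ≃g GI n 2 j) {Φ : IDart n ≃ IDart n} (hΦ1 : ∀ d, (Φ d).1 = φ d.1)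
    (hΦ2 : ∀ d, endpoint (j 0 : ZMod n) (j 1) (Φ d) = φ (endpoint (j 0 : ZMod n) (j 1) d))
    {x y : Fin 2 × ZMod n} (hxy : (GI n 2 j).Adj x y) (h : x.2 = y.2)
    (hφ : (φ x).2 ≠ (φ y).2) (k : Option (Fin 2)) :
    ∃ d : IDart n, edgeKind d.1.1 d.2 = k ∧ edgeKind (Φ d).1.1 (Φ d).2 ≠ k := by
  have hne : x.1 ≠ y.1 := fun h' => hxy.ne (Prod.ext h' h)
  cases k with
  | none =>
    refine ⟨(x, 0), rfl, fun h0 => hφ ?_⟩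
    have he : (Φ (x, 0)).2 = 0 := by
      by_contra h'
      simp [edgeKind, h'] at h0
    have hy : endpoint (j 0 : ZMod n) (j 1) (x, 0) = y := by
      rw [endpoint_eq]
      refine Prod.ext ?_ (by simpa using h)
      have : ∀ s r : Fin 2, s ≠ r → s + 1 = r := by decide
      simpa [turn] using this _ _ hne
    rw [← hy, ← hΦ2, endpoint_eq, he, hΦ1]
    simp
  | some r =>
    by_contra! hr
    have hlayer : ∀ v, (φ (r, v)).1 = r := by
      intro v
      have := hr ((r, v), 1) (by simp [edgeKind])
      rw [hΦ1] at this
      unfold edgeKind at this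
      split_ifs at this
      exact Option.some.inj this
    have hsurj : Function.Surjective fun v => (φ (r, v)).2 := by
      refine Finite.surjective_of_injective fun v w hvw => ?_
      have := φ.injective (Prod.ext ((hlayer v).trans (hlayer w).symm) hvw)
      exact congrArg Prod.snd this
    have hiff : ∀ z : Fin 2 × ZMod n, (φ z).1 = r ↔ z.1 = r := by
      rintro ⟨s, v⟩
      constructor
      · intro hz
        obtain ⟨w, hw⟩ := hsurj (φ (s, v)).2
        have := φ.injective (Prod.ext ((hlayer w).trans hz.symm) hw)
        exact (congrArg Prod.fst this).symm
      · rintro rfl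
        exact hlayer v
    rcases (adj_iff hj _ _).1 (φ.map_adj_iff.2 hxy) with ⟨h', -⟩ | ⟨h', -⟩
    · exact hφ h'
    · have hx := hiff x
      have hy := hiff y
      rw [h'] at hx
      have : ∀ s s' r : Fin 2, (s = r ↔ s' = r) → s = s' := by decide
      exact hne (this _ _ r (hx.symm.trans hy))

theorem apply_some_eq_apply_none {α : Type*} {F : Option (Fin 2) → α}
    (hF : ∀ k, ∃ k', k' ≠ k ∧ F k' = F k) (r : Fin 2) : F (some r) = F none := by
  have hcases : ∀ k : Option (Fin 2), k = none ∨ k = some 0 ∨ k = some 1 := by decide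
  have h01 : F (some 0) = F none ∧ F (some 1) = F none := by
    obtain ⟨k₀, h₀, e₀⟩ := hF (some 0)
    obtain ⟨k₁, h₁, e₁⟩ := hF (some 1)
    obtain ⟨k₂, h₂, e₂⟩ := hF none
    rcases hcases k₀ with rfl | rfl | rfl <;> rcases hcases k₁ with rfl | rfl | rfl <;>
      rcases hcases k₂ with rfl | rfl | rfl <;> grind
  fin_cases r
  exacts [h01.1, h01.2]

/-- In an I-graph with a skew automorphism, all edges lie on the same number of closed
non-backtracking walks of a given length. -/
theorem tally_eq_of_skew [NeZero n] (hj : ∀ s, (j s : ZMod n) ≠ 0)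
    (hj2 : ∀ s, 2 * (j s : ZMod n) ≠ 0) (φ : GI n 2 j ≃g GI n 2 j)
    {x y : Fin 2 × ZMod n} (hxy : (GI n 2 j).Adj x y) (h : x.2 = y.2)
    (hφ : (φ x).2 ≠ (φ y).2) {m : ℕ} {l : Option (Fin 2) → List (ℕ × (ℤ × ℤ))}
    (hl : ∀ (s : Fin 2) (e : SignType),
      List.isPerm ((((walkEnds m s e (0, 0)).filter fun x => x.1 = (s, e)).map
        fun x => signNormal x.2)) ((l (edgeKind s e)).flatMap
        fun x => List.replicate x.1 x.2) = true) (r : Fin 2) :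
    tally (fun p => evalVoltage (j 0 : ZMod n) (j 1) p = 0) (l (some r)) =
      tally (fun p => evalVoltage (j 0 : ZMod n) (j 1) p = 0) (l none) := by
  obtain ⟨Φ, hΦ1, hΦ2, hΦ⟩ := exists_dartEquiv hj hj2 φ
  have hinv : ∀ d, tally (fun p => evalVoltage (j 0 : ZMod n) (j 1) p = 0)
        (l (edgeKind (Φ d).1.1 (Φ d).2)) =
      tally (fun p => evalVoltage (j 0 : ZMod n) (j 1) p = 0) (l (edgeKind d.1.1 d.2)) := by
    intro d
    rw [← walkCount_self_eq_tally _ _ hl, ← walkCount_self_eq_tally _ _ hl]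
    exact walkCount_equiv _ Φ hΦ m d d
  have hother : ∀ k, ∃ k', k' ≠ k ∧
      tally (fun p => evalVoltage (j 0 : ZMod n) (j 1) p = 0) (l k') =
      tally (fun p => evalVoltage (j 0 : ZMod n) (j 1) p = 0) (l k) := by
    intro k
    obtain ⟨d, rfl, hd⟩ := exists_edgeKind_ne hj φ hΦ1 hΦ2 hxy h hφ k
    exact ⟨_, hd, hinv d⟩
  exact apply_some_eq_apply_none
    (F := fun k => tally (fun p => evalVoltage (j 0 : ZMod n) (j 1) p = 0) (l k)) hother r

end Skew

end GI
namespace GI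

section Arithmetic

/-- The relations between the layer parameters that create extra `8`-cycles through layer edges. -/
def layerRelations : List (ℤ × ℤ) :=
  [(8, 0), (0, 8), (1, -5), (1, 5), (2, -4), (2, 4), (3, -3), (3, 3), (4, -2), (4, 2), (5, -1),
    (5, 1)]

/-- The possible moduli of the I-graphs satisfying two of the `layerRelations`. -/
def smallModuli : List ℕ :=
  [3, 4, 5, 6, 7, 8, 9, 10, 11, 12, 13, 14, 16, 18, 20, 22, 24, 26, 32, 40, 64]

theorem mem_smallModuli : ∀ p ∈ layerRelations, ∀ q ∈ layerRelations, p ≠ q →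
    p.1 * q.2 - p.2 * q.1 ≠ 0 ∧ ∀ n ≤ (p.1 * q.2 - p.2 * q.1).natAbs,
      n ∣ (p.1 * q.2 - p.2 * q.1).natAbs → 3 ≤ n → n ∈ smallModuli := by
  decide +kernel

theorem one_lt_countP_layerRelations {R : Type*} [Ring R] [DecidableEq R] {a b : R}
    (ha : 2 * a ≠ 0) (hb : 2 * b ≠ 0)
    (h : ∀ r, tally (fun p => evalVoltage a b p = 0) (octagons (some r)) =
      tally (fun p => evalVoltage a b p = 0) (octagons none)) :
    1 < layerRelations.countP fun p => evalVoltage a b p = 0 := by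
  have h0 := h 0
  have h1 := h 1
  have z00 : evalVoltage a b (0, 0) = 0 := by simp [evalVoltage]
  have z20 : evalVoltage a b (2, 0) ≠ 0 := by simpa [evalVoltage] using ha
  have z02 : evalVoltage a b (0, 2) ≠ 0 := by simpa [evalVoltage] using hb
  simp only [layerRelations, List.countP_cons, List.countP_nil, decide_eq_true_eq]
  simp only [tally, octagons, List.map_cons, List.map_nil, List.sum_cons, List.sum_nil, z00,
    z20, z02, if_true, if_false] at h0 h1
  omega

theorem exists_ne_of_one_lt_countP {α : Type*} {P : α → Prop} [DecidablePred P] {l : List α}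
    (hl : l.Nodup) (h : 1 < l.countP P) : ∃ p ∈ l, ∃ q ∈ l, p ≠ q ∧ P p ∧ P q := by
  rw [List.countP_eq_length_filter] at h
  have hnd := hl.filter (fun x => decide (P x))
  have hmem : ∀ x ∈ l.filter (fun x => decide (P x)), x ∈ l ∧ P x := by simp
  match hf : l.filter (fun x => decide (P x)) with
  | [] => simp [hf] at h
  | [_] => simp [hf] at h
  | p :: q :: _ =>
    rw [hf] at hnd hmem
    have hp := hmem p (by simp)
    have hq := hmem q (by simp)
    exact ⟨p, hp.1, q, hq.1, by rintro rfl; simp at hnd, hp.2, hq.2⟩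

/-- The candidates for the parameter `k` of an edge-transitive generalised Petersen graph
`GI(n; 1, k)`. -/
def specialParams : ℕ → List ℕ
  | 4 => [1]
  | 5 => [2]
  | 8 => [3]
  | 10 => [2, 3]
  | 12 => [5]
  | 24 => [5]
  | _ => []

/-- Multiplication by `u` carries the pair `(a, b)` to `(± 1, ± k)` modulo `n`. -/
def CarriesTo (n k u : ℕ) (a b : ℕ) : Prop :=
  ((n : ℤ) ∣ u * a - 1 ∨ (n : ℤ) ∣ u * a + 1) ∧ ((n : ℤ) ∣ u * b - k ∨ (n : ℤ) ∣ u * b + k)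

instance (n k u a b : ℕ) : Decidable (CarriesTo n k u a b) :=
  inferInstanceAs (Decidable (_ ∧ _))

/-- The numerical conditions on an I-graph forced by a skew automorphism. -/
def SkewConditions (n a b : ℕ) : Prop :=
  Nat.gcd (Nat.gcd a b) n = 1 ∧ ¬ n ∣ 2 * a ∧ ¬ n ∣ 2 * b ∧
    1 < (layerRelations.countP fun p => (p.1 * (a : ℤ) + p.2 * b) % n = 0) ∧
    (∀ r, tally (fun p => (p.1 * (a : ℤ) + p.2 * b) % n = 0) (octagons (some r)) =
      tally (fun p => (p.1 * (a : ℤ) + p.2 * b) % n = 0) (octagons none)) ∧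
    ∀ r, tally (fun p => (p.1 * (a : ℤ) + p.2 * b) % n = 0) (decagons (some r)) =
      tally (fun p => (p.1 * (a : ℤ) + p.2 * b) % n = 0) (decagons none)

instance (n a b : ℕ) : Decidable (SkewConditions n a b) :=
  inferInstanceAs (Decidable (_ ∧ _))

theorem exists_carriesTo : ∀ n ∈ smallModuli, ∀ a < n, ∀ b < n, SkewConditions n a b →
    ∃ k ∈ specialParams n, ∃ u < n, Nat.Coprime u n ∧
      (CarriesTo n k u a b ∨ CarriesTo n k u b a) := by
  decide +kernel

end Arithmetic

section Classification

variable {n : ℕ} {j : Fin 2 → ℤ}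

theorem evalVoltage_eq_zero_iff [NeZero n] (a b : ZMod n) (p : ℤ × ℤ) :
    evalVoltage a b p = 0 ↔ (p.1 * (a.val : ℤ) + p.2 * b.val) % n = 0 := by
  rw [← Int.dvd_iff_emod_eq_zero, ← ZMod.intCast_zmod_eq_zero_iff_dvd]
  simp [evalVoltage]

theorem mem_smallModuli_of_skew (hn : 3 ≤ n) (hj : ∀ s, (j s : ZMod n) ≠ 0)
    (hconn : (GI n 2 j).Connected)
    (h : 1 < layerRelations.countP fun p => evalVoltage (j 0 : ZMod n) (j 1) p = 0) :
    n ∈ smallModuli := by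
  obtain ⟨p, hp, q, hq, hpq, hp0, hq0⟩ := exists_ne_of_one_lt_countP (by decide) h
  obtain ⟨hdet, hmem⟩ := mem_smallModuli p hp q hq hpq
  have hzero := intCast_eq_zero_of_connected (m := p.1 * q.2 - p.2 * q.1) hj hconn <| by
    unfold evalVoltage at hp0 hq0
    push_cast
    rw [Fin.forall_fin_two]
    constructor
    · linear_combination (q.2 : ZMod n) * hp0 - (p.2 : ZMod n) * hq0
    · linear_combination (p.1 : ZMod n) * hq0 - (q.1 : ZMod n) * hp0
  have hdvd := Int.natCast_dvd.1 ((ZMod.intCast_zmod_eq_zero_iff_dvd _ n).1 hzero)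
  exact hmem n (Nat.le_of_dvd (Int.natAbs_pos.2 hdet) hdvd) hdvd hn

theorem gcd_val_eq_one_of_connected (hn : 3 ≤ n) (hj : ∀ s, (j s : ZMod n) ≠ 0)
    (hconn : (GI n 2 j).Connected) :
    Nat.gcd (Nat.gcd (j 0 : ZMod n).val (j 1 : ZMod n).val) n = 1 := by
  have : NeZero n := ⟨by omega⟩
  set g := Nat.gcd (Nat.gcd (j 0 : ZMod n).val (j 1 : ZMod n).val) n with hg
  obtain ⟨m, hm⟩ : g ∣ n := Nat.gcd_dvd_right _ _
  have hval : ∀ s, g ∣ (j s : ZMod n).val := by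
    have h := Nat.gcd_dvd_left (Nat.gcd (j 0 : ZMod n).val (j 1 : ZMod n).val) n
    intro s
    fin_cases s
    · exact h.trans (Nat.gcd_dvd_left _ _)
    · exact h.trans (Nat.gcd_dvd_right _ _)
  have hzero := intCast_eq_zero_of_connected (m := m) hj hconn fun s => by
    obtain ⟨c, hc⟩ := hval s
    rw [← ZMod.natCast_zmod_val (j s : ZMod n), hc]
    have : ((m * (g * c) : ℕ) : ZMod n) = 0 := by
      rw [ZMod.natCast_eq_zero_iff]
      exact ⟨c, by rw [hm]; ring⟩
    exact_mod_cast this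
  have hdvd : n ∣ m := (ZMod.natCast_eq_zero_iff m n).1 (by exact_mod_cast hzero)
  have hm0 : 0 < m := Nat.pos_of_ne_zero (by rintro rfl; omega)
  have hle := Nat.le_of_dvd hm0 hdvd
  rw [hm] at hle
  have hg0 : 0 < g := Nat.pos_of_ne_zero (by intro h0; rw [h0] at hm; omega)
  nlinarith

theorem CarriesTo.eq {k u : ℕ} [NeZero n] {a b : ZMod n} (h : CarriesTo n k u a.val b.val) :
    ((1 : ZMod n) = u * a ∨ (1 : ZMod n) = -(u * a)) ∧
      ((k : ZMod n) = u * b ∨ (k : ZMod n) = -(u * b)) := by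
  unfold CarriesTo at h
  simp only [← ZMod.intCast_zmod_eq_zero_iff_dvd] at h
  push_cast at h
  simp only [ZMod.natCast_val, ZMod.cast_id', id_eq] at h
  refine h.imp (Or.imp ?_ ?_) (Or.imp ?_ ?_) <;> intro h
  · linear_combination -h
  · linear_combination h
  · linear_combination -h
  · linear_combination h

theorem nonempty_iso_of_carriesTo [NeZero n] {k u : ℕ} (hu : Nat.Coprime u n)
    (h : CarriesTo n k u (j 0 : ZMod n).val (j 1 : ZMod n).val ∨
      CarriesTo n k u (j 1 : ZMod n).val (j 0 : ZMod n).val) :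
    Nonempty (GI n 2 j ≃g GI n 2 ![1, k]) := by
  rcases h with h | h
  · refine nonempty_iso_of_unit (ZMod.unitOfCoprime u hu) (Equiv.refl _) fun s => ?_
    fin_cases s
    · simpa using h.eq.1
    · simpa using h.eq.2
  · refine nonempty_iso_of_unit (ZMod.unitOfCoprime u hu) (Equiv.swap 0 1) fun s => ?_
    fin_cases s
    · simpa using h.eq.2
    · simpa using h.eq.1

/-- A connected I-graph with a skew automorphism is one of the special generalised Petersen
graphs. -/
theorem exists_specialParams_of_skew (hn : 3 ≤ n) (hj : ∀ s, (j s : ZMod n) ≠ 0)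
    (hj2 : ∀ s, 2 * (j s : ZMod n) ≠ 0) (hconn : (GI n 2 j).Connected) (φ : GI n 2 j ≃g GI n 2 j)
    {x y : Fin 2 × ZMod n} (hxy : (GI n 2 j).Adj x y) (h : x.2 = y.2)
    (hφ : (φ x).2 ≠ (φ y).2) :
    n ∈ smallModuli ∧ ∃ k ∈ specialParams n, Nonempty (GI n 2 j ≃g GI n 2 ![1, k]) := by
  have : NeZero n := ⟨by omega⟩
  have h8 := tally_eq_of_skew hj hj2 φ hxy h hφ walkEnds_eight_perm
  have h10 := tally_eq_of_skew hj hj2 φ hxy h hφ walkEnds_ten_perm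
  have hrel := one_lt_countP_layerRelations (hj2 0) (hj2 1) h8
  have hmem := mem_smallModuli_of_skew hn hj hconn hrel
  have hval : ∀ a : ZMod n, 2 * a ≠ 0 → ¬ n ∣ 2 * a.val := by
    intro a ha hdvd
    rw [← ZMod.natCast_eq_zero_iff] at hdvd
    exact ha (by simpa using hdvd)
  simp only [evalVoltage_eq_zero_iff] at h8 h10 hrel
  obtain ⟨k, hk, u, -, hu, hcarry⟩ := exists_carriesTo n hmem _ (ZMod.val_lt _) _ (ZMod.val_lt _)
    ⟨gcd_val_eq_one_of_connected hn hj hconn, hval _ (hj2 0), hval _ (hj2 1), hrel, h8, h10⟩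
  exact ⟨hmem, k, hk, nonempty_iso_of_carriesTo hu hcarry⟩

end Classification

end GI

/-- a connected GI-graph with `t ≥ 2` layers admitting a skew automorphism
(one mapping some spoke edge to a layer edge) is isomorphic to one of the eight special
GI-graphs. -/
theorem GI_skew_classification (n t : ℕ) (hn : 3 ≤ n) (ht : 2 ≤ t) (j : Fin t → ℤ)
    (hj : ∀ s, (j s : ZMod n) ≠ 0 ∧ ((2 * j s : ℤ) : ZMod n) ≠ 0)
    (hconn : (GI n t j).Connected)
    (φ : GI n t j ≃g GI n t j)
    (hskew : ∃ x y : Fin t × ZMod n,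
      (GI n t j).Adj x y ∧ x.2 = y.2 ∧ (φ x).2 ≠ (φ y).2) :
    Nonempty (GI n t j ≃g GI 4 2 ![1, 1]) ∨
    Nonempty (GI n t j ≃g GI 5 2 ![1, 2]) ∨
    Nonempty (GI n t j ≃g GI 8 2 ![1, 3]) ∨
    Nonempty (GI n t j ≃g GI 10 2 ![1, 2]) ∨
    Nonempty (GI n t j ≃g GI 10 2 ![1, 3]) ∨
    Nonempty (GI n t j ≃g GI 12 2 ![1, 5]) ∨
    Nonempty (GI n t j ≃g GI 24 2 ![1, 5]) ∨
    Nonempty (GI n t j ≃g GI 3 3 ![1, 1, 1]) := by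
  obtain ⟨x, y, hxy, h, hφ⟩ := hskew
  have hj1 : ∀ s, (j s : ZMod n) ≠ 0 := fun s => (hj s).1
  have hj2 : ∀ s, 2 * (j s : ZMod n) ≠ 0 := fun s => by simpa using (hj s).2
  rcases ht.lt_or_eq with ht | rfl
  · obtain ⟨rfl, rfl⟩ := GI.eq_three_of_skew hn ht hj1 hj2 hconn φ hxy h hφ
    simp only [GI.nonempty_iso_three hj1, or_true]
  · obtain ⟨hmem, k, hk, hiso⟩ :=
      GI.exists_specialParams_of_skew hn hj1 hj2 hconn φ hxy h hφ
    simp only [GI.smallModuli, List.mem_cons, List.not_mem_nil, or_false] at hmem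
    rcases hmem with rfl | rfl | rfl | rfl | rfl | rfl | rfl | rfl | rfl | rfl | rfl | rfl | rfl |
        rfl | rfl | rfl | rfl | rfl | rfl | rfl | rfl <;>
      simp only [GI.specialParams, List.mem_cons, List.not_mem_nil, or_false] at hk
    all_goals
      first
      | (subst hk; push_cast at hiso; simp only [hiso, true_or, or_true])
      | (rcases hk with rfl | rfl <;> push_cast at hiso <;> simp only [hiso, true_or, or_true])
end

section
/- Let n ≥ 3, t ≥ 2, and let j : Fin t → ℤ satisfy j s ≢ 0 (mod n) and 2·(j s) ≢ 0 (mod n) for all s. If X = GI(n;j) is connected and edge-transitive (its automorphism group acts transitively on edges), then X is isomorphic to one of the eight graphs GI(4;1,1), GI(5;1,2), GI(8;1,3), GI(10;1,2), GI(10;1,3), GI(12;1,5), GI(24;1,5), GI(3;1,1,1). -/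
open SimpleGraph

theorem GI_adj {n t : ℕ} {j : Fin t → ℤ} {x y : Fin t × ZMod n} :
    (GI n t j).Adj x y ↔ x ≠ y ∧ (x.2 = y.2 ∨
      (x.1 = y.1 ∧ (y.2 = x.2 + (j x.1 : ZMod n) ∨ x.2 = y.2 + (j x.1 : ZMod n)))) := by
  obtain ⟨s, v⟩ := x
  obtain ⟨s', v'⟩ := y
  simp only [GI, SimpleGraph.fromRel_adj, ne_eq, Prod.mk.injEq]
  constructor
  · rintro ⟨h, (⟨h1, h2⟩ | ⟨rfl, h2⟩) | (⟨h1, h2⟩ | ⟨rfl, h2⟩)⟩ <;> simp_all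
  · rintro ⟨h, h1 | ⟨rfl, h2 | h2⟩⟩ <;> simp_all

/-- Multiplication by a unit together with a permutation of the layers is an isomorphism. -/
theorem GI_iso {n t : ℕ} {j j' : Fin t → ℤ} (σ : Equiv.Perm (Fin t)) (u : (ZMod n)ˣ)
    (h : ∀ s, (j' (σ s) : ZMod n) = u * j s ∨ (j' (σ s) : ZMod n) = -(u * j s)) :
    Nonempty (GI n t j ≃g GI n t j') := by
  refine ⟨⟨Equiv.prodCongr σ (Units.mulLeft u), ?_⟩⟩
  rintro ⟨s, v⟩ ⟨s', v'⟩
  have e : ∀ p q r : ZMod n, (u : ZMod n) * p = u * q + u * r ↔ p = q + r := fun p q r => by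
    rw [← mul_add, Units.mul_right_inj]
  have e' : ∀ p q r : ZMod n, (u : ZMod n) * p = u * q + -(u * r) ↔ q = p + r := fun p q r => by
    rw [← e q]
    constructor <;> intro h <;> linear_combination -h
  simp only [GI_adj, Equiv.prodCongr_apply, Prod.map, Units.mulLeft_apply, ne_eq, Prod.mk.injEq,
    Units.mul_right_inj, EmbeddingLike.apply_eq_iff_eq]
  rcases h s with h | h <;> rw [h]
  · rw [e, e]
  · rw [e', e', or_comm (a := v = v' + _)]

/-- The reflection `(s, v) ↦ (s, c - v)`. -/
def GIreflect (n t : ℕ) (j : Fin t → ℤ) (c : ZMod n) : GI n t j ≃g GI n t j where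
  toEquiv := Equiv.prodCongr (Equiv.refl _) (Equiv.subLeft c)
  map_rel_iff' := by
    rintro ⟨s, v⟩ ⟨s', v'⟩
    have e : ∀ p q r : ZMod n, c - p = c - q + r ↔ q = p + r := fun p q r => by
      constructor <;> intro h <;> linear_combination h
    simp only [GI_adj, Equiv.prodCongr_apply, Prod.map, Equiv.subLeft_apply, ne_eq, Prod.mk.injEq,
      sub_right_inj, Equiv.refl_apply, e]
    rw [or_comm (a := v = v' + _)]

theorem GIreflect_apply {n t : ℕ} (j : Fin t → ℤ) (c : ZMod n) (x : Fin t × ZMod n) :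
    GIreflect n t j c x = (x.1, c - x.2) := rfl

/-- An integer annihilating all `j s` in a connected GI-graph vanishes modulo `n`. -/
theorem GI_connected_annihilator {n t : ℕ} {j : Fin t → ℤ} (h0 : 0 < t)
    (hc : (GI n t j).Connected)
    (d : ℤ) (hd : ∀ s, (d : ZMod n) * j s = 0) : (d : ZMod n) = 0 := by
  have key : ∀ x y : Fin t × ZMod n, (GI n t j).Reachable x y → (d : ZMod n) * x.2 = d * y.2 := by
    rintro x y ⟨w⟩
    induction w with
    | nil => rfl
    | cons h _ ih =>
      rw [← ih]
      rcases (GI_adj.1 h).2 with h | ⟨-, h | h⟩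
      · rw [h]
      · rw [h, mul_add, hd, add_zero]
      · rw [h, mul_add, hd, add_zero]
  simpa using (key (⟨0, h0⟩, 0) (⟨0, h0⟩, 1) (hc.preconnected _ _)).symm

section ArcCount

open Classical in
/-- The number of nonbacktracking walks of `k` steps starting with the arc `(u, v)` and ending
with the arc `(x, y)`. -/
noncomputable def arcCount {V : Type*} [Fintype V] (G : SimpleGraph V) (x y : V) :
    ℕ → V → V → ℕ
  | 0, u, v => if u = x ∧ v = y then 1 else 0
  | k + 1, u, v => ∑ w ∈ Finset.univ.filter (fun w => G.Adj v w ∧ w ≠ u), arcCount G x y k v w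

theorem arcCount_map {V : Type*} [Fintype V] {G : SimpleGraph V} (φ : G ≃g G) (x y : V) (k : ℕ) :
    ∀ u v, arcCount G (φ x) (φ y) k (φ u) (φ v) = arcCount G x y k u v := by
  induction k with
  | zero =>
    intro u v
    exact @if_congr _ _ _ (_) (_) _ _ _ _ (and_congr φ.injective.eq_iff φ.injective.eq_iff) rfl rfl
  | succ k ih =>
    intro u v
    simp only [arcCount]
    symm
    refine Finset.sum_equiv φ.toEquiv (fun w => ?_) (fun w _ => (ih v w).symm)
    simp only [Finset.mem_filter, Finset.mem_univ, true_and]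
    refine and_congr (φ.map_adj_iff).symm ?_
    exact not_congr (EmbeddingLike.apply_eq_iff_eq φ).symm

end ArcCount

/-- A formal arc of a two-layer GI-graph: it ends at `(layer, x * j 0 + y * j 1)` and traverses a
spoke if `lab = 0` and a layer edge, forwards or backwards, if `lab = 1` or `lab = -1`. -/
structure FormalArc where
  layer : Fin 2
  x : ℤ
  y : ℤ
  lab : ℤ

/-- The formal arc that follows `t` and has label `m`. -/
def FormalArc.step (t : FormalArc) (m : ℤ) : FormalArc :=
  if m = 0 then ⟨1 - t.layer, t.x, t.y, 0⟩
  else if t.layer = 0 then ⟨0, t.x + m, t.y, m⟩ else ⟨1, t.x, t.y + m, m⟩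

/-- The last arcs of all nonbacktracking walks of `k` steps that start with a given arc. -/
def FormalArc.ends : ℕ → FormalArc → List FormalArc
  | 0, t => [t]
  | k + 1, t => (([0, 1, -1] : List ℤ).filter (fun m => t.lab + m ≠ 0)).flatMap
      (fun m => FormalArc.ends k (t.step m))

/-- The neighbour of `v` along the edge with label `m`. -/
def GInbr (n : ℕ) (j : Fin 2 → ℤ) (v : Fin 2 × ZMod n) (m : ℤ) : Fin 2 × ZMod n :=
  if m = 0 then (1 - v.1, v.2) else (v.1, v.2 + m * j v.1)

/-- The end vertex of a formal arc. -/
def FormalArc.pos (n : ℕ) (j : Fin 2 → ℤ) (t : FormalArc) : Fin 2 × ZMod n :=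
  (t.layer, ((t.x * j 0 + t.y * j 1 : ℤ) : ZMod n))

/-- The initial vertex of a formal arc. -/
def FormalArc.prev (n : ℕ) (j : Fin 2 → ℤ) (t : FormalArc) : Fin 2 × ZMod n :=
  GInbr n j (t.pos n j) (-t.lab)

theorem fin_two_one_sub_ne (s : Fin 2) : 1 - s ≠ s := by
  fin_cases s <;> decide

theorem fin_two_eq_or (s s' : Fin 2) : s' = s ∨ s' = 1 - s := by
  fin_cases s <;> fin_cases s' <;> decide

theorem FormalArc.pos_step {n : ℕ} (j : Fin 2 → ℤ) (t : FormalArc) (m : ℤ) :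
    (t.step m).pos n j = GInbr n j (t.pos n j) m := by
  obtain ⟨s, x, y, l⟩ := t
  unfold FormalArc.step GInbr FormalArc.pos
  fin_cases s <;> by_cases hm : m = 0 <;> simp [hm] <;> ring

theorem FormalArc.lab_step (t : FormalArc) (m : ℤ) : (t.step m).lab = m := by
  unfold FormalArc.step
  split_ifs with h <;> simp [h]

theorem GInbr_GInbr_neg {n : ℕ} (j : Fin 2 → ℤ) (v : Fin 2 × ZMod n) (m : ℤ) :
    GInbr n j (GInbr n j v m) (-m) = v := by
  obtain ⟨s, v⟩ := v
  unfold GInbr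
  by_cases hm : m = 0 <;> simp [hm]

theorem FormalArc.prev_step {n : ℕ} (j : Fin 2 → ℤ) (t : FormalArc) (m : ℤ) :
    (t.step m).prev n j = t.pos n j := by
  rw [FormalArc.prev, FormalArc.pos_step, FormalArc.lab_step, GInbr_GInbr_neg]

theorem GInbr_injOn {n : ℕ} {j : Fin 2 → ℤ}
    (hj : ∀ s, (j s : ZMod n) ≠ 0 ∧ ((2 * j s : ℤ) : ZMod n) ≠ 0) (v : Fin 2 × ZMod n) :
    Set.InjOn (GInbr n j v) (({0, 1, -1} : Finset ℤ) : Set ℤ) := by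
  obtain ⟨s, v⟩ := v
  have h1 := fin_two_one_sub_ne s
  have h2 : (j s : ZMod n) ≠ -(j s : ZMod n) := fun h => (hj s).2 (by
    push_cast; linear_combination h)
  intro p hp q hq h
  simp only [Finset.coe_insert, Finset.coe_singleton, Set.mem_insert_iff,
    Set.mem_singleton_iff] at hp hq
  rcases hp with rfl | rfl | rfl <;> rcases hq with rfl | rfl | rfl <;>
    simp_all [GInbr, h1.symm, h2.symm]

theorem GI_adj_iff_GInbr {n : ℕ} {j : Fin 2 → ℤ}
    (hj : ∀ s, (j s : ZMod n) ≠ 0 ∧ ((2 * j s : ℤ) : ZMod n) ≠ 0) (v w : Fin 2 × ZMod n) :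
    (GI n 2 j).Adj v w ↔ ∃ m ∈ ({0, 1, -1} : Finset ℤ), GInbr n j v m = w := by
  obtain ⟨s, v⟩ := v
  obtain ⟨s', w⟩ := w
  have h1 := fin_two_one_sub_ne s
  have h2 := (hj s).1
  simp only [GI_adj, GInbr, Finset.mem_insert, Finset.mem_singleton, exists_eq_or_imp,
    exists_eq_left]
  rcases fin_two_eq_or s s' with rfl | rfl
  · simp [h1]
    constructor
    · rintro ⟨h, h' | h' | h'⟩
      · exact absurd h' h
      · exact Or.inl h'.symm
      · right; rw [h']; ring
    · rintro (rfl | rfl) <;> simp [h2]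
  · simp [h1.symm]

theorem arcCount_GI {n : ℕ} [NeZero n] {j : Fin 2 → ℤ}
    (hj : ∀ s, (j s : ZMod n) ≠ 0 ∧ ((2 * j s : ℤ) : ZMod n) ≠ 0) (s : Fin 2) (k : ℕ) :
    ∀ t : FormalArc, t.lab ∈ ({0, 1, -1} : Finset ℤ) →
    arcCount (GI n 2 j) (s, -(j s : ZMod n)) (s, 0) k (t.prev n j) (t.pos n j) =
      (t.ends k).countP (fun t => t.layer = s ∧ t.lab = 1 ∧ (n : ℤ) ∣ t.x * j 0 + t.y * j 1) := by
  induction k with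
  | zero =>
    intro t ht
    rw [arcCount, FormalArc.ends, List.countP_singleton]
    refine @if_congr _ _ _ (_) (_) _ _ _ _ (Iff.trans ?_ decide_eq_true_iff.symm) rfl rfl
    rw [← ZMod.intCast_zmod_eq_zero_iff_dvd]
    constructor
    · rintro ⟨h1, h2⟩
      have h3 : GInbr n j (t.pos n j) (-t.lab) = GInbr n j (t.pos n j) (-1) := by
        rw [show GInbr n j (t.pos n j) (-t.lab) = t.prev n j from rfl, h1, h2]
        simp [GInbr]
      have h4 := GInbr_injOn hj _ (by
        simp only [Finset.mem_insert, Finset.mem_singleton, Finset.mem_coe] at ht ⊢; omega)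
        (by simp) h3
      simp only [FormalArc.pos, Prod.mk.injEq] at h2
      exact ⟨h2.1, by omega, h2.2⟩
    · rintro ⟨h1, h2, h3⟩
      simp [FormalArc.prev, FormalArc.pos, h1, h2, h3, GInbr]
  | succ k ih =>
    intro t ht
    have hl : ∀ m ∈ ({0, 1, -1} : Finset ℤ),
        arcCount (GI n 2 j) (s, -(j s : ZMod n)) (s, 0) k (t.pos n j) (GInbr n j (t.pos n j) m) =
        ((t.step m).ends k).countP
          (fun t => t.layer = s ∧ t.lab = 1 ∧ (n : ℤ) ∣ t.x * j 0 + t.y * j 1) := by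
      intro m hm
      rw [← ih _ (by rwa [FormalArc.lab_step]), FormalArc.prev_step, FormalArc.pos_step]
    have ht' : -t.lab ∈ ({0, 1, -1} : Finset ℤ) := by
      simp only [Finset.mem_insert, Finset.mem_singleton] at ht ⊢; omega
    rw [arcCount]
    refine (Finset.sum_nbij (s := ({0, 1, -1} : Finset ℤ).filter (fun m => t.lab + m ≠ 0))
      (GInbr n j (t.pos n j)) ?_ ?_ ?_
      (fun m hm => (hl m (Finset.mem_filter.1 hm).1).symm)).symm.trans ?_
    · intro m hm
      rw [Finset.mem_filter] at hm
      simp only [Finset.mem_filter, Finset.mem_univ, true_and, GI_adj_iff_GInbr hj]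
      refine ⟨⟨m, hm.1, rfl⟩, fun h' => hm.2 ?_⟩
      have := GInbr_injOn hj _ (Finset.mem_coe.2 hm.1) (Finset.mem_coe.2 ht') h'
      omega
    · exact (GInbr_injOn hj _).mono (Finset.coe_subset.2 (Finset.filter_subset _ _))
    · intro w hw
      simp only [Finset.coe_filter, Finset.mem_univ, true_and, Set.mem_ofPred_eq,
        GI_adj_iff_GInbr hj] at hw
      obtain ⟨⟨m, hm, rfl⟩, h⟩ := hw
      refine ⟨m, Finset.mem_coe.2 (Finset.mem_filter.2 ⟨hm, fun h' => h ?_⟩), rfl⟩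
      rw [FormalArc.prev, show m = -t.lab by omega]
    rw [FormalArc.ends, List.countP_flatMap]
    simp only [Finset.mem_insert, Finset.mem_singleton] at ht
    rcases ht with h | h | h <;> rw [h] <;> simp [Finset.filter_insert, Finset.filter_singleton]

/-- The coefficient vectors `(x, y)` of the closed nonbacktracking walks of length `k + 1` that
start with a forward edge of layer `s` followed by the edge with label `m`. -/
def closedWalks (k : ℕ) (s : Fin 2) (m : ℤ) : List (ℤ × ℤ) :=
  ((((⟨s, 0, 0, 1⟩ : FormalArc).step m).ends k).filter (fun t => t.layer = s ∧ t.lab = 1)).map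
    (fun t => (t.x, t.y))

/-- The number of vectors in a list that give a relation between `a` and `b` modulo `n`. -/
def relCount (n : ℕ) (a b : ℤ) (l : List (ℤ × ℤ)) : ℕ :=
  l.countP (fun r => (n : ℤ) ∣ r.1 * a + r.2 * b)

theorem exists_automorphism_layer_to_spoke {n : ℕ} {j : Fin 2 → ℤ}
    (hj : ∀ s, (j s : ZMod n) ≠ 0 ∧ ((2 * j s : ℤ) : ZMod n) ≠ 0)
    (hET : ∀ e ∈ (GI n 2 j).edgeSet, ∀ f ∈ (GI n 2 j).edgeSet,
      ∃ φ : GI n 2 j ≃g GI n 2 j, Sym2.map (fun x => φ x) e = f) (s : Fin 2) :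
    ∃ φ : GI n 2 j ≃g GI n 2 j, φ (s, 0) = (s, 0) ∧ φ (s, (j s : ZMod n)) = (1 - s, 0) ∧
      φ (s, -(j s : ZMod n)) = (s, -(j s : ZMod n)) := by
  have hs := fin_two_one_sub_ne s
  have h1 : (GI n 2 j).Adj (s, 0) (s, (j s : ZMod n)) := by
    simp [GI_adj, (hj s).1.symm]
  have h2 : (GI n 2 j).Adj (s, 0) (1 - s, 0) := by
    simp [GI_adj, hs.symm]
  have h3 : (GI n 2 j).Adj (s, 0) (s, -(j s : ZMod n)) := by
    simp [GI_adj, (hj s).1]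
  have hA : ∃ φ : GI n 2 j ≃g GI n 2 j, φ (s, 0) = (s, 0) ∧ φ (s, (j s : ZMod n)) = (1 - s, 0) := by
    obtain ⟨φ, hφ⟩ := hET s((s, 0), (s, (j s : ZMod n))) h1 s((s, 0), (1 - s, 0)) h2
    rw [Sym2.map_mk, Sym2.eq_iff] at hφ
    rcases hφ with h | ⟨h, h'⟩
    · exact ⟨φ, h⟩
    · refine ⟨(GIreflect n 2 j (j s : ZMod n)).trans φ, ?_, ?_⟩ <;>
        simp [RelIso.trans_apply, GIreflect_apply, h, h']
  obtain ⟨φ, h0, hp⟩ := hA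
  have h4 : (GI n 2 j).Adj (s, 0) (φ (s, -(j s : ZMod n))) := by
    rw [← h0]; exact φ.map_adj_iff.2 h3
  obtain ⟨m, hm, h5⟩ := (GI_adj_iff_GInbr hj _ _).1 h4
  simp only [Finset.mem_insert, Finset.mem_singleton] at hm
  rcases hm with rfl | rfl | rfl
  · exfalso
    have h6 : φ (s, -(j s : ZMod n)) = φ (s, (j s : ZMod n)) := by
      rw [hp, ← h5]; simp [GInbr]
    have h7 := congrArg Prod.snd (φ.injective h6)
    refine (hj s).2 ?_
    push_cast
    linear_combination -h7
  · refine ⟨φ.trans (GIreflect n 2 j 0), ?_, ?_, ?_⟩ <;>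
      simp [RelIso.trans_apply, GIreflect_apply, h0, hp, ← h5, GInbr]
  · exact ⟨φ, h0, hp, by simp [← h5, GInbr]⟩

theorem relCount_closedWalks_eq {n : ℕ} [NeZero n] {j : Fin 2 → ℤ}
    (hj : ∀ s, (j s : ZMod n) ≠ 0 ∧ ((2 * j s : ℤ) : ZMod n) ≠ 0)
    (hET : ∀ e ∈ (GI n 2 j).edgeSet, ∀ f ∈ (GI n 2 j).edgeSet,
      ∃ φ : GI n 2 j ≃g GI n 2 j, Sym2.map (fun x => φ x) e = f) (s : Fin 2) (k : ℕ) :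
    relCount n (j 0) (j 1) (closedWalks k s 1) = relCount n (j 0) (j 1) (closedWalks k s 0) := by
  have key : ∀ m ∈ ({0, 1, -1} : Finset ℤ), relCount n (j 0) (j 1) (closedWalks k s m) =
      arcCount (GI n 2 j) (s, -(j s : ZMod n)) (s, 0) k (s, 0) (GInbr n j (s, 0) m) := by
    intro m hm
    have h := arcCount_GI hj s k ((⟨s, 0, 0, 1⟩ : FormalArc).step m) (by
      rwa [FormalArc.lab_step])
    rw [FormalArc.prev_step, FormalArc.pos_step] at h
    have hpos : (⟨s, 0, 0, 1⟩ : FormalArc).pos n j = (s, 0) := by simp [FormalArc.pos]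
    rw [hpos] at h
    rw [h, relCount, closedWalks, List.countP_map, List.countP_filter]
    congr 1
    ext t
    simp only [Function.comp_apply, Bool.decide_and]
    rw [Bool.and_comm, Bool.and_assoc]
  obtain ⟨φ, h0, hp, hm⟩ := exists_automorphism_layer_to_spoke hj hET s
  rw [key 1 (by simp), key 0 (by simp)]
  have h := arcCount_map φ (s, -(j s : ZMod n)) (s, 0) k (s, 0) (s, (j s : ZMod n))
  rw [h0, hp, hm] at h
  simpa [GInbr] using h.symm

theorem relCount_congr {n : ℕ} {a b a' b' : ℤ}
    (h : ∀ x y : ℤ, (n : ℤ) ∣ x * a + y * b ↔ (n : ℤ) ∣ x * a' + y * b') (l : List (ℤ × ℤ)) :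
    relCount n a b l = relCount n a' b' l := by
  unfold relCount
  congr 1
  ext r
  exact decide_eq_decide.2 (h r.1 r.2)

/-- The determinant of two coefficient vectors. -/
def vecDet (r q : ℤ × ℤ) : ℤ := r.1 * q.2 - q.1 * r.2

/-- All closed nonbacktracking walks of length eight that start in one of four ways. -/
def closedWalksEight : List (ℤ × ℤ) :=
  closedWalks 7 0 1 ++ closedWalks 7 0 0 ++ closedWalks 7 1 1 ++ closedWalks 7 1 0

theorem relCount_ge (n : ℕ) (a b : ℤ) {r : ℤ × ℤ} (hr : (n : ℤ) ∣ r.1 * a + r.2 * b)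
    (l : List (ℤ × ℤ)) :
    l.countP (fun q => q = 0 ∨ q = r ∨ q = -r) ≤ relCount n a b l := by
  refine List.countP_mono_left fun q _ h => ?_
  rw [decide_eq_true_iff] at h ⊢
  rcases h with rfl | rfl | rfl
  · simp
  · exact hr
  · rw [Prod.fst_neg, Prod.snd_neg, show -r.1 * a + -r.2 * b = -(r.1 * a + r.2 * b) by ring]
    exact (dvd_neg).2 hr

theorem closedWalks_count_conflict : ∀ r ∈ closedWalks 7 0 1,
    (closedWalks 7 0 1).countP (fun q => vecDet r q = 0) <
      (closedWalks 7 0 0).countP (fun q => q = 0 ∨ q = r ∨ q = -r) ∨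
    (closedWalks 7 1 1).countP (fun q => vecDet r q = 0) <
      (closedWalks 7 1 0).countP (fun q => q = 0 ∨ q = r ∨ q = -r) := by
  decide +kernel

theorem zero_mem_closedWalks : (0, 0) ∈ closedWalks 7 0 0 := by
  decide +kernel

theorem relCount_le {n : ℕ} {a b : ℤ} {r : ℤ × ℤ} {l : List (ℤ × ℤ)}
    (h : ∀ q ∈ l, (n : ℤ) ∣ q.1 * a + q.2 * b → vecDet r q = 0) :
    relCount n a b l ≤ l.countP (fun q => vecDet r q = 0) := by
  refine List.countP_mono_left fun q hq hrel => ?_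
  rw [decide_eq_true_iff] at hrel ⊢
  exact h q hq hrel

theorem exists_nonproportional_relations {n : ℕ} {a b : ℤ}
    (h0 : relCount n a b (closedWalks 7 0 1) = relCount n a b (closedWalks 7 0 0))
    (h1 : relCount n a b (closedWalks 7 1 1) = relCount n a b (closedWalks 7 1 0)) :
    ∃ r ∈ closedWalks 7 0 1, ∃ q ∈ closedWalksEight, (n : ℤ) ∣ r.1 * a + r.2 * b ∧
      (n : ℤ) ∣ q.1 * a + q.2 * b ∧ vecDet r q ≠ 0 := by
  have key := closedWalks_count_conflict
  have hpos : 0 < relCount n a b (closedWalks 7 0 0) :=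
    List.countP_pos_iff.2 ⟨_, zero_mem_closedWalks, by simp⟩
  rw [← h0] at hpos
  unfold closedWalksEight
  generalize closedWalks 7 0 1 = l₁ at *
  generalize closedWalks 7 0 0 = l₂ at *
  generalize closedWalks 7 1 1 = l₃ at *
  generalize closedWalks 7 1 0 = l₄ at *
  by_contra! H
  obtain ⟨r, hr, hrel⟩ := List.countP_pos_iff.1 hpos
  rw [decide_eq_true_iff] at hrel
  have u0 := relCount_le fun q (hq : q ∈ l₁) h => H r hr q (by simp [hq]) hrel h
  have u1 := relCount_le fun q (hq : q ∈ l₃) h => H r hr q (by simp [hq]) hrel h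
  have g0 := relCount_ge n a b hrel l₂
  have g1 := relCount_ge n a b hrel l₄
  have := key r hr
  omega

/-- The parameters `n, j 0, j 1` of the seven two-layer graphs. -/
def cubicParameters : List (ℕ × ℕ × ℕ) :=
  [(4, 1, 1), (5, 1, 2), (8, 1, 3), (10, 1, 2), (10, 1, 3), (12, 1, 5), (24, 1, 5)]

/-- Some multiple of `(a, b)` by a unit of `ZMod n` is `(c, d)` up to signs. -/
def unitRelated (n : ℕ) (a b : ℤ) (c d : ℤ) : Bool :=
  (List.range n).any fun u => Nat.gcd u n = 1 ∧
    ((n : ℤ) ∣ c - u * a ∨ (n : ℤ) ∣ c + u * a) ∧ ((n : ℤ) ∣ d - u * b ∨ (n : ℤ) ∣ d + u * b)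

/-- Up to a unit of `ZMod n`, signs and the order of the layers, `(n, a, b)` is listed. -/
def isCubicParameter (n : ℕ) (a b : ℤ) : Bool :=
  cubicParameters.any fun p => p.1 = n &&
    (unitRelated n a b p.2.1 p.2.2 || unitRelated n a b p.2.2 p.2.1)

/-- The possible orders of the layers when there are two nonproportional relations. -/
def smallOrders : List ℕ :=
  [3, 4, 5, 6, 7, 8, 9, 10, 11, 12, 13, 14, 16, 18, 20, 22, 24, 26, 32, 40, 64]

theorem mem_smallOrders {n : ℕ} (hn : 3 ≤ n) {r q : ℤ × ℤ} (hr : r ∈ closedWalks 7 0 1)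
    (hq : q ∈ closedWalksEight) (h : vecDet r q ≠ 0) (hd : (n : ℤ) ∣ vecDet r q) :
    n ∈ smallOrders := by
  have h1 : ∀ r ∈ closedWalks 7 0 1, ∀ q ∈ closedWalksEight, vecDet r q ≠ 0 →
      (vecDet r q).natAbs ∈ [2, 4, 6, 8, 10, 12, 14, 16, 18, 20, 22, 24, 26, 32, 40, 64] := by
    decide +kernel
  have h2 : ∀ d ∈ [2, 4, 6, 8, 10, 12, 14, 16, 18, 20, 22, 24, 26, 32, 40, 64],
      ∀ n ∈ List.range 65, 3 ≤ n → n ∣ d → n ∈ smallOrders := by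
    decide +kernel
  have h3 := h1 r hr q hq h
  have h4 := Int.natCast_dvd.1 hd
  have h5 : n ≤ (vecDet r q).natAbs := Nat.le_of_dvd (Int.natAbs_pos.2 h) h4
  have h6 : (vecDet r q).natAbs ≤ 64 := by
    have : ∀ d ∈ [2, 4, 6, 8, 10, 12, 14, 16, 18, 20, 22, 24, 26, 32, 40, 64], d ≤ 64 := by
      decide
    exact this _ h3
  exact h2 _ h3 n (List.mem_range.2 (by omega)) hn h4

theorem small_parameters : ∀ n ∈ smallOrders, ∀ a ∈ n.divisors, ∀ b ∈ List.range n,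
    (!decide ((n : ℤ) ∣ 2 * a) && !decide ((n : ℤ) ∣ 2 * b) && Nat.gcd a b == 1 &&
      relCount n a b (closedWalks 7 0 1) == relCount n a b (closedWalks 7 0 0) &&
      relCount n a b (closedWalks 7 1 1) == relCount n a b (closedWalks 7 1 0) &&
      relCount n a b (closedWalks 9 0 1) == relCount n a b (closedWalks 9 0 0)) = true →
    isCubicParameter n a b = true := by
  decide +kernel

theorem exists_unit_of_unitRelated {n : ℕ} {a b c d : ℤ} (h : unitRelated n a b c d = true) :
    ∃ u : (ZMod n)ˣ, ((c : ZMod n) = u * a ∨ (c : ZMod n) = -(u * a)) ∧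
      ((d : ZMod n) = u * b ∨ (d : ZMod n) = -(u * b)) := by
  obtain ⟨u, -, hu⟩ := List.any_eq_true.1 h
  obtain ⟨hu, hc, hd⟩ := decide_eq_true_iff.1 hu
  have key : ∀ x y : ℤ, ((n : ℤ) ∣ x - u * y ∨ (n : ℤ) ∣ x + u * y) →
      (x : ZMod n) = (u : ZMod n) * y ∨ (x : ZMod n) = -((u : ZMod n) * y) := by
    intro x y h
    simp only [← ZMod.intCast_zmod_eq_zero_iff_dvd] at h
    push_cast at h
    exact h.imp sub_eq_zero.1 eq_neg_of_add_eq_zero_left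
  exact ⟨ZMod.unitOfCoprime u hu, key _ _ hc, key _ _ hd⟩

theorem exists_cubicParameter {n : ℕ} (hn : 3 ≤ n) {a b : ℤ} (ha : ¬ (n : ℤ) ∣ 2 * a)
    (hb : ¬ (n : ℤ) ∣ 2 * b) (hg : ∀ d : ℤ, (n : ℤ) ∣ d * a → (n : ℤ) ∣ d * b → (n : ℤ) ∣ d)
    (h0 : relCount n a b (closedWalks 7 0 1) = relCount n a b (closedWalks 7 0 0))
    (h1 : relCount n a b (closedWalks 7 1 1) = relCount n a b (closedWalks 7 1 0))
    (h2 : relCount n a b (closedWalks 9 0 1) = relCount n a b (closedWalks 9 0 0)) :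
    ∃ p ∈ cubicParameters, p.1 = n ∧ ∃ u : (ZMod n)ˣ,
      (((p.2.1 : ZMod n) = u * a ∨ (p.2.1 : ZMod n) = -(u * a)) ∧
        ((p.2.2 : ZMod n) = u * b ∨ (p.2.2 : ZMod n) = -(u * b))) ∨
      (((p.2.2 : ZMod n) = u * a ∨ (p.2.2 : ZMod n) = -(u * a)) ∧
        ((p.2.1 : ZMod n) = u * b ∨ (p.2.1 : ZMod n) = -(u * b))) := by
  have : NeZero n := ⟨by omega⟩
  have hmem : n ∈ smallOrders := by
    obtain ⟨r, hr, q, hq, hrr, hqq, hdet⟩ := exists_nonproportional_relations h0 h1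
    refine mem_smallOrders hn hr hq hdet (hg _ ?_ ?_)
    · have h := dvd_sub (hrr.mul_left q.2) (hqq.mul_left r.2)
      rwa [show q.2 * (r.1 * a + r.2 * b) - r.2 * (q.1 * a + q.2 * b) = vecDet r q * a by
        unfold vecDet; ring] at h
    · have h := dvd_sub (hqq.mul_left r.1) (hrr.mul_left q.1)
      rwa [show r.1 * (q.1 * a + q.2 * b) - q.1 * (r.1 * a + r.2 * b) = vecDet r q * b by
        unfold vecDet; ring] at h
  obtain ⟨d, hd, u, hu, hau⟩ := ZMod.eq_unit_mul_divisor (a : ZMod n)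
  obtain ⟨u, rfl⟩ := hu
  obtain ⟨c, hc, hcb⟩ : ∃ c : ℕ, c < n ∧ (c : ZMod n) = (u⁻¹ : (ZMod n)ˣ) * b :=
    ⟨((u⁻¹ : (ZMod n)ˣ) * b : ZMod n).val, ZMod.val_lt _, ZMod.natCast_rightInverse _⟩
  have had : (d : ZMod n) = (u⁻¹ : (ZMod n)ˣ) * a := by
    rw [hau, Units.inv_mul_cancel_left]
  have hrel : ∀ x y : ℤ, (n : ℤ) ∣ x * a + y * b ↔ (n : ℤ) ∣ x * d + y * c := by
    intro x y
    rw [← ZMod.intCast_zmod_eq_zero_iff_dvd, ← ZMod.intCast_zmod_eq_zero_iff_dvd]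
    push_cast
    rw [had, hcb, ← Units.mul_right_eq_zero u⁻¹]
    ring_nf
  have hcubic : isCubicParameter n d c = true := by
    refine small_parameters n hmem d (Nat.mem_divisors.2 ⟨hd, by omega⟩) c
      (List.mem_range.2 hc) ?_
    simp only [Bool.and_eq_true, Bool.not_eq_true', decide_eq_false_iff_not, beq_iff_eq,
      ← relCount_congr hrel]
    refine ⟨⟨⟨⟨⟨?_, ?_⟩, ?_⟩, h0⟩, h1⟩, h2⟩
    · simpa [hrel] using (not_congr (hrel 2 0)).1 (by simpa using ha)
    · simpa [hrel] using (not_congr (hrel 0 2)).1 (by simpa using hb)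
    · obtain ⟨k, hk⟩ := Nat.gcd_dvd_left d c
      obtain ⟨l, hl⟩ := Nat.gcd_dvd_right d c
      obtain ⟨m, hm⟩ := (Nat.gcd_dvd_left d c).trans hd
      have hnm : (n : ℤ) ∣ m := by
        refine hg m ?_ ?_
        · have := (hrel m 0).2 (by
            rw [zero_mul, add_zero]
            refine ⟨k, ?_⟩
            exact_mod_cast (show m * d = n * k by nth_rw 1 [hk]; rw [hm]; ring))
          simpa using this
        · have := (hrel 0 m).2 (by
            rw [zero_mul, zero_add]
            refine ⟨l, ?_⟩
            exact_mod_cast (show m * c = n * l by nth_rw 1 [hl]; rw [hm]; ring))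
          simpa using this
      have h3 := Int.natCast_dvd_natCast.1 hnm
      rcases Nat.eq_zero_or_pos m with rfl | hm0
      · omega
      · have h4 := Nat.le_of_dvd hm0 h3
        rcases Nat.lt_or_ge 1 (Nat.gcd d c) with h5 | h5
        · nlinarith
        · rcases Nat.eq_zero_or_pos (Nat.gcd d c) with h6 | h6
          · rw [h6] at hm; omega
          · omega
  obtain ⟨p, hp, hp'⟩ := List.any_eq_true.1 hcubic
  rw [Bool.and_eq_true, decide_eq_true_iff, Bool.or_eq_true] at hp'
  refine ⟨p, hp, hp'.1, ?_⟩
  rcases hp'.2 with h | h <;> obtain ⟨w, h3, h4⟩ := exists_unit_of_unitRelated h <;>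
    simp only [Int.cast_natCast, had, hcb, ← mul_assoc, ← Units.val_mul] at h3 h4
  · exact ⟨w * u⁻¹, Or.inl ⟨h3, h4⟩⟩
  · exact ⟨w * u⁻¹, Or.inr ⟨h3, h4⟩⟩

theorem exists_iso_cubicParameter {n : ℕ} (hn : 3 ≤ n) {j : Fin 2 → ℤ}
    (hj : ∀ s, (j s : ZMod n) ≠ 0 ∧ ((2 * j s : ℤ) : ZMod n) ≠ 0)
    (hconn : (GI n 2 j).Connected)
    (hET : ∀ e ∈ (GI n 2 j).edgeSet, ∀ f ∈ (GI n 2 j).edgeSet,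
      ∃ φ : GI n 2 j ≃g GI n 2 j, Sym2.map (fun x => φ x) e = f) :
    ∃ p ∈ cubicParameters, Nonempty (GI n 2 j ≃g GI p.1 2 ![(p.2.1 : ℤ), (p.2.2 : ℤ)]) := by
  have : NeZero n := ⟨by omega⟩
  have h2 : ∀ s, ¬ (n : ℤ) ∣ 2 * j s := fun s h =>
    (hj s).2 ((ZMod.intCast_zmod_eq_zero_iff_dvd _ _).2 h)
  obtain ⟨p, hp, rfl, u, hu⟩ := exists_cubicParameter hn (h2 0) (h2 1) (by
      intro d h0 h1
      rw [← ZMod.intCast_zmod_eq_zero_iff_dvd] at h0 h1 ⊢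
      push_cast at h0 h1
      exact GI_connected_annihilator two_pos hconn d (Fin.forall_fin_two.2 ⟨h0, h1⟩))
    (relCount_closedWalks_eq hj hET 0 7) (relCount_closedWalks_eq hj hET 1 7)
    (relCount_closedWalks_eq hj hET 0 9)
  refine ⟨p, hp, ?_⟩
  rcases hu with ⟨h0, h1⟩ | ⟨h0, h1⟩
  · exact GI_iso (Equiv.refl _) u (Fin.forall_fin_two.2 ⟨by simpa using h0, by simpa using h1⟩)
  · exact GI_iso (Equiv.swap 0 1) u
      (Fin.forall_fin_two.2 ⟨by simpa using h0, by simpa using h1⟩)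

theorem common_neighbor_of_layer_edge {n t : ℕ} {j : Fin t → ℤ}
    (hj : ∀ s, (j s : ZMod n) ≠ 0 ∧ ((2 * j s : ℤ) : ZMod n) ≠ 0) {s : Fin t}
    {x : Fin t × ZMod n} (h0 : (GI n t j).Adj (s, 0) x)
    (h1 : (GI n t j).Adj (s, (j s : ZMod n)) x) :
    x = (s, -(j s : ZMod n)) ∧ (3 : ZMod n) * j s = 0 := by
  obtain ⟨s', v⟩ := x
  have h2 := (hj s).1
  have h3 := (hj s).2
  push_cast at h3
  simp only [GI_adj, ne_eq, Prod.mk.injEq] at h0 h1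
  obtain ⟨h0, h0'⟩ := h0
  obtain ⟨h1, h1'⟩ := h1
  rcases h0' with h | ⟨rfl, h | h⟩
  · rcases h1' with h' | ⟨rfl, -⟩
    · exact absurd (h'.trans h.symm) h2
    · exact absurd ⟨rfl, h⟩ h0
  · exact absurd ⟨rfl, by rw [h, zero_add]⟩ h1
  · have hv : v = -(j s : ZMod n) := eq_neg_of_add_eq_zero_left h.symm
    subst hv
    refine ⟨rfl, ?_⟩
    rcases h1' with h' | ⟨-, h' | h'⟩
    · exact absurd (by linear_combination h') h3
    · linear_combination -h'
    · exact absurd (by linear_combination h') h2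

theorem exists_layer_edge_of_spokes {n t : ℕ} {j : Fin t → ℤ}
    (hj : ∀ s, (j s : ZMod n) ≠ 0 ∧ ((2 * j s : ℤ) : ZMod n) ≠ 0)
    (hET : ∀ e ∈ (GI n t j).edgeSet, ∀ f ∈ (GI n t j).edgeSet,
      ∃ φ : GI n t j ≃g GI n t j, Sym2.map (fun x => φ x) e = f)
    {s₀ s₁ : Fin t} (h01 : s₀ ≠ s₁) (s : Fin t) :
    ∃ φ : GI n t j ≃g GI n t j, ∀ s₂, s₂ ≠ s₀ → s₂ ≠ s₁ →
      φ (s₂, 0) = (s, -(j s : ZMod n)) ∧ (3 : ZMod n) * j s = 0 := by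
  have h1 : (GI n t j).Adj (s₀, 0) (s₁, 0) := by simp [GI_adj, h01]
  have h2 : (GI n t j).Adj (s, 0) (s, (j s : ZMod n)) := by simp [GI_adj, (hj s).1.symm]
  obtain ⟨φ, hφ⟩ := hET s((s₀, 0), (s₁, 0)) h1 s((s, 0), (s, (j s : ZMod n))) h2
  refine ⟨φ, fun s₂ h20 h21 => ?_⟩
  have h3 : (GI n t j).Adj (φ (s₀, 0)) (φ (s₂, 0)) :=
    φ.map_adj_iff.2 (by simp [GI_adj, h20.symm])
  have h4 : (GI n t j).Adj (φ (s₁, 0)) (φ (s₂, 0)) :=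
    φ.map_adj_iff.2 (by simp [GI_adj, h21.symm])
  rw [Sym2.map_mk, Sym2.eq_iff] at hφ
  rcases hφ with ⟨h5, h6⟩ | ⟨h5, h6⟩ <;> rw [h5] at h3 <;> rw [h6] at h4
  · exact common_neighbor_of_layer_edge hj h3 h4
  · exact common_neighbor_of_layer_edge hj h4 h3

theorem layers_le_three {n t : ℕ} {j : Fin t → ℤ}
    (hj : ∀ s, (j s : ZMod n) ≠ 0 ∧ ((2 * j s : ℤ) : ZMod n) ≠ 0)
    (hET : ∀ e ∈ (GI n t j).edgeSet, ∀ f ∈ (GI n t j).edgeSet,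
      ∃ φ : GI n t j ≃g GI n t j, Sym2.map (fun x => φ x) e = f) : t ≤ 3 := by
  by_contra! ht
  obtain ⟨φ, hφ⟩ := exists_layer_edge_of_spokes hj hET (s₀ := ⟨0, by omega⟩)
    (s₁ := ⟨1, by omega⟩) (by simp) ⟨0, by omega⟩
  have h2 := (hφ ⟨2, by omega⟩ (by simp) (by simp)).1
  have h3 := (hφ ⟨3, by omega⟩ (by simp) (by simp)).1
  simpa using φ.injective (h2.trans h3.symm)

theorem iso_of_three_layers {n : ℕ} (hn : 3 ≤ n) {j : Fin 3 → ℤ}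
    (hj : ∀ s, (j s : ZMod n) ≠ 0 ∧ ((2 * j s : ℤ) : ZMod n) ≠ 0)
    (hconn : (GI n 3 j).Connected)
    (hET : ∀ e ∈ (GI n 3 j).edgeSet, ∀ f ∈ (GI n 3 j).edgeSet,
      ∃ φ : GI n 3 j ≃g GI n 3 j, Sym2.map (fun x => φ x) e = f) :
    Nonempty (GI n 3 j ≃g GI 3 3 ![1, 1, 1]) := by
  have h3 : ((3 : ℤ) : ZMod n) = 0 := by
    refine GI_connected_annihilator three_pos hconn 3 fun s => ?_
    obtain ⟨φ, hφ⟩ := exists_layer_edge_of_spokes hj hET (s₀ := 0) (s₁ := 1) (by decide) s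
    exact_mod_cast (hφ 2 (by decide) (by decide)).2
  have h4 : n ∣ 3 := by
    have := (ZMod.intCast_zmod_eq_zero_iff_dvd _ _).1 h3
    exact_mod_cast this
  obtain rfl : n = 3 := le_antisymm (Nat.le_of_dvd three_pos h4) hn
  refine GI_iso (Equiv.refl _) 1 fun s => ?_
  have h5 : ((![1, 1, 1] : Fin 3 → ℤ) s : ZMod 3) = 1 := by
    fin_cases s <;> simp
  have h6 : ∀ x : ZMod 3, x ≠ 0 → 1 = x ∨ 1 = -x := by decide
  rw [Equiv.refl_apply, h5, Units.val_one, one_mul]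
  exact h6 _ (hj s).1

/-- a connected edge-transitive GI-graph with `t ≥ 2` layers is isomorphic
to one of the eight special GI-graphs. -/
theorem GI_edge_transitive_classification (n t : ℕ) (hn : 3 ≤ n) (ht : 2 ≤ t)
    (j : Fin t → ℤ)
    (hj : ∀ s, (j s : ZMod n) ≠ 0 ∧ ((2 * j s : ℤ) : ZMod n) ≠ 0)
    (hconn : (GI n t j).Connected)
    (hET : ∀ e ∈ (GI n t j).edgeSet, ∀ f ∈ (GI n t j).edgeSet,
      ∃ φ : GI n t j ≃g GI n t j, Sym2.map (fun x => φ x) e = f) :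
    Nonempty (GI n t j ≃g GI 4 2 ![1, 1]) ∨
    Nonempty (GI n t j ≃g GI 5 2 ![1, 2]) ∨
    Nonempty (GI n t j ≃g GI 8 2 ![1, 3]) ∨
    Nonempty (GI n t j ≃g GI 10 2 ![1, 2]) ∨
    Nonempty (GI n t j ≃g GI 10 2 ![1, 3]) ∨
    Nonempty (GI n t j ≃g GI 12 2 ![1, 5]) ∨
    Nonempty (GI n t j ≃g GI 24 2 ![1, 5]) ∨
    Nonempty (GI n t j ≃g GI 3 3 ![1, 1, 1]) := by
  have ht3 := layers_le_three hj hET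
  obtain rfl | rfl : t = 2 ∨ t = 3 := by omega
  · obtain ⟨p, hp, hiso⟩ := exists_iso_cubicParameter hn hj hconn hET
    simp only [cubicParameters, List.mem_cons, List.not_mem_nil, or_false] at hp
    rcases hp with rfl | rfl | rfl | rfl | rfl | rfl | rfl <;>
      simp only [Nat.cast_one, Nat.cast_ofNat] at hiso <;> tauto
  · exact Or.inr <| Or.inr <| Or.inr <| Or.inr <| Or.inr <| Or.inr <| Or.inr <|
      iso_of_three_layers hn hj hconn hET
end

section
/- Let n ≥ 3, t ≥ 1, and let j : Fin t → ℤ satisfy 0 < j s < n/2 for all s, with the values j s pairwise distinct. Suppose X = GI(n;j) is connected and every automorphism of X respects the fundamental edge-partition. Let J = {(j s : ZMod n) : s ∈ Fin t} and let A = {a ∈ (ZMod n)ˣ : a·(J ∪ −J) = J ∪ −J}. Then the automorphism group of X has order n·|A|. -/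
open SimpleGraph

/-- The map `f` is affine on every coset of the cyclic subgroup generated by `x`. -/
def AffineAlong {G : Type*} [AddCommGroup G] (f : G → G) (x : G) : Prop :=
  ∀ v, ∃ c, ∀ k : ℕ, f (v + k • x) = f v + k • c

theorem AffineAlong.nsmul {G : Type*} [AddCommGroup G] {f : G → G} {x : G}
    (hx : AffineAlong f x) (m : ℕ) : AffineAlong f (m • x) := by
  intro v
  obtain ⟨c, hc⟩ := hx v
  exact ⟨m • c, fun k => by rw [← mul_nsmul', ← mul_nsmul', hc]⟩

theorem AffineAlong.add_of_coprime {G : Type*} [AddCommGroup G] {f : G → G} {x y : G}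
    (hx : AffineAlong f x) (hy : AffineAlong f y)
    (hxy : (addOrderOf x).Coprime (addOrderOf y)) : AffineAlong f (x + y) := by
  have torsion : ∀ {z c v : G}, (∀ k : ℕ, f (v + k • z) = f v + k • c) →
      addOrderOf z • c = 0 := by
    intro z c v h
    simpa [addOrderOf_nsmul_eq_zero] using h (addOrderOf z)
  intro v
  obtain ⟨c, hc⟩ := hx v
  obtain ⟨d, hd⟩ := hy v
  refine ⟨c + d, fun k => ?_⟩
  obtain ⟨c', hc'⟩ := hx (v + k • y)
  obtain ⟨d', hd'⟩ := hy (v + k • x)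
  have e : k • c + k • d' = k • d + k • c' := by
    have h₁ := hd' k
    have h₂ := hc' k
    rw [hc] at h₁
    rw [hd, add_right_comm v, h₁, add_assoc, add_assoc] at h₂
    exact add_left_cancel h₂
  have e' : k • (c - c') = k • (d - d') := by
    rw [nsmul_sub, nsmul_sub, sub_eq_sub_iff_add_eq_add, e]
  have hz : k • (d - d') = 0 := by
    have h₁ : addOrderOf x • (k • (d - d')) = 0 := by
      rw [← e', nsmul_left_comm, nsmul_sub, torsion hc, torsion hc', sub_zero, nsmul_zero]
    have h₂ : addOrderOf y • (k • (d - d')) = 0 := by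
      rw [nsmul_left_comm, nsmul_sub, torsion hd, torsion hd', sub_zero, nsmul_zero]
    rw [← AddMonoid.addOrderOf_eq_one_iff]
    exact Nat.eq_one_of_dvd_coprimes hxy (addOrderOf_dvd_of_nsmul_eq_zero h₁)
      (addOrderOf_dvd_of_nsmul_eq_zero h₂)
  have hd'' : k • d' = k • d := by
    rw [nsmul_sub, sub_eq_zero] at hz
    exact hz.symm
  rw [nsmul_add, nsmul_add, ← add_assoc, hd', hc, hd'', add_assoc]

theorem AffineAlong.exists_addOrderOf_eq_lcm {G : Type*} [AddCommGroup G] [Finite G]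
    {f : G → G} {x y : G} (hx : AffineAlong f x) (hy : AffineAlong f y) :
    ∃ z, AffineAlong f z ∧ addOrderOf z = (addOrderOf x).lcm (addOrderOf y) := by
  have hx0 : addOrderOf x ≠ 0 := (addOrderOf_pos x).ne'
  have hy0 : addOrderOf y ≠ 0 := (addOrderOf_pos y).ne'
  refine ⟨_, ?_, (AddCommute.all x y).addOrderOf_add_nsmul_eq_lcm hx0 hy0⟩
  refine (hx.nsmul _).add_of_coprime (hy.nsmul _) ?_
  rw [addOrderOf_nsmul_addOrderOf_sub hx0 (Nat.factorizationLCMLeft_dvd_left _ _),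
    addOrderOf_nsmul_addOrderOf_sub hy0 (Nat.factorizationLCMRight_dvd_right _ _)]
  exact Nat.coprime_factorizationLCMLeft_factorizationLCMRight _ _

/-- A self-map of `ZMod n` that is affine along a set of directions generating `ZMod n`
is affine. -/
theorem AffineAlong.one_of_generators {n : ℕ} [NeZero n] {f : ZMod n → ZMod n}
    {S : Set (ZMod n)} (hS : ∀ x ∈ S, AffineAlong f x)
    (hgen : ∀ m : ℕ, (∀ x ∈ S, m • x = 0) → m • (1 : ZMod n) = 0) : AffineAlong f 1 := by
  have h0 : AffineAlong f 0 := fun v => ⟨0, by simp⟩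
  obtain ⟨x, hx, hmax⟩ := Set.exists_max_image {x | AffineAlong f x} addOrderOf
    (Set.toFinite _) ⟨0, h0⟩
  have hn : n ∣ addOrderOf x := by
    have h : addOrderOf x • (1 : ZMod n) = 0 := by
      refine hgen _ fun y hy => ?_
      obtain ⟨z, hz, hzo⟩ := AffineAlong.exists_addOrderOf_eq_lcm hx (hS y hy)
      have hle := hmax z hz
      rw [hzo] at hle
      have heq := le_antisymm hle (Nat.le_of_dvd
        (Nat.lcm_pos (addOrderOf_pos x) (addOrderOf_pos y)) (Nat.dvd_lcm_left _ _))
      exact addOrderOf_dvd_iff_nsmul_eq_zero.1 (heq ▸ Nat.dvd_lcm_right _ _)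
    rwa [nsmul_one, ZMod.natCast_eq_zero_iff] at h
  have htop : AddSubgroup.zmultiples x = ⊤ := by
    apply AddSubgroup.eq_top_of_le_card
    rw [Nat.card_zmod, Nat.card_zmultiples]
    exact Nat.le_of_dvd (addOrderOf_pos x) hn
  have h1 : (1 : ZMod n) ∈ AddSubmonoid.multiples x := by
    rw [mem_multiples_iff_mem_zmultiples, htop]
    trivial
  obtain ⟨k, hk⟩ := h1
  have := hx.nsmul k
  rwa [show k • x = 1 from hk] at this

theorem intCast_zmod_injective_of_abs_lt {n : ℕ} {a b : ℤ} (hab : |a - b| < n)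
    (h : (a : ZMod n) = b) : a = b := by
  rw [← sub_eq_zero, ← Int.cast_sub, ZMod.intCast_zmod_eq_zero_iff_dvd] at h
  exact sub_eq_zero.1 (Int.eq_zero_of_abs_lt_dvd h hab)

theorem GI_adj_iff {n t : ℕ} {j : Fin t → ℤ} (hj : ∀ s, (j s : ZMod n) ≠ 0)
    (x y : Fin t × ZMod n) : (GI n t j).Adj x y ↔
      (x.2 = y.2 ∧ x.1 ≠ y.1) ∨
        (x.1 = y.1 ∧ (y.2 - x.2 = j x.1 ∨ y.2 - x.2 = -(j x.1 : ZMod n))) := by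
  obtain ⟨s, v⟩ := x
  obtain ⟨s', v'⟩ := y
  simp only [GI, SimpleGraph.fromRel_adj, ne_eq, Prod.mk.injEq, sub_eq_iff_eq_add]
  have hs := hj s
  constructor
  · rintro ⟨-, (h | ⟨rfl, h⟩) | (⟨h, h'⟩ | ⟨rfl, h⟩)⟩
    · exact .inl h
    · exact .inr ⟨rfl, .inl (by rw [h, add_comm])⟩
    · exact .inl ⟨h.symm, fun e => h' e.symm⟩
    · exact .inr ⟨rfl, .inr (by rw [h]; ring)⟩
  · rintro (⟨rfl, h'⟩ | ⟨rfl, rfl | rfl⟩)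
    · exact ⟨fun e => h' e.1, .inl (.inl ⟨rfl, h'⟩)⟩
    · exact ⟨fun e => hs (by simpa using e.2), .inl (.inr ⟨rfl, add_comm _ _⟩)⟩
    · exact ⟨fun e => hs (by simpa using e.2), .inr (.inr ⟨rfl, by ring⟩)⟩

theorem mem_JJset_iff {n t : ℕ} {j : Fin t → ℤ} {x : ZMod n} :
    x ∈ JJset n j ↔ ∃ s, x = j s ∨ x = -(j s : ZMod n) := by
  simp only [JJset, Jset, Set.mem_union, Set.mem_range, Set.mem_image, exists_exists_eq_and,
    exists_or, eq_comm (a := x)]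

/-- A sequence whose consecutive differences are all `± d` and that never turns back
is an arithmetic progression. -/
theorem eq_add_nsmul_of_sub_eq_or_neg {G : Type*} [AddCommGroup G] {u : ℕ → G} {d : G}
    (hstep : ∀ k, u (k + 1) - u k = d ∨ u (k + 1) - u k = -d)
    (hturn : ∀ k, u (k + 2) ≠ u k) (k : ℕ) : u k = u 0 + k • (u 1 - u 0) := by
  have hconst : ∀ k, u (k + 1) - u k = u 1 - u 0 := by
    intro k
    induction k with
    | zero => rfl
    | succ k ih =>
      rw [← ih]
      have hk := hturn k
      have hne : u (k + 1 + 1) - u (k + 1) ≠ -(u (k + 1) - u k) := by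
        intro e
        rw [neg_sub, sub_left_inj] at e
        exact hk e
      rcases hstep k with h | h <;> rcases hstep (k + 1) with h' | h' <;> rw [h, h'] at hne ⊢ <;>
        simp at hne
  induction k with
  | zero => simp
  | succ k ih => rw [succ_nsmul, ← add_assoc, ← ih, ← hconst k, add_sub_cancel]

/-- The automorphism `(s, v) ↦ (σ s, a v + b)` of `GI n t j`. -/
def affineIso {n t : ℕ} {j : Fin t → ℤ} (hj : ∀ s, (j s : ZMod n) ≠ 0)
    (σ : Equiv.Perm (Fin t)) (a : (ZMod n)ˣ) (b : ZMod n)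
    (hσ : ∀ s, (a : ZMod n) * j s = j (σ s) ∨ (a : ZMod n) * j s = -(j (σ s) : ZMod n)) :
    GI n t j ≃g GI n t j where
  toEquiv := Equiv.prodCongr σ (a.mulLeft.trans (Equiv.addRight b))
  map_rel_iff' := by
    rintro ⟨s, v⟩ ⟨s', v'⟩
    have hd : (a : ZMod n) * v' + b - (a * v + b) = a * (v' - v) := by ring
    have key : (a * (v' - v) = j (σ s) ∨ a * (v' - v) = -(j (σ s) : ZMod n)) ↔
        (v' - v = j s ∨ v' - v = -(j s : ZMod n)) := by
      have h₁ : v' - v = j s ↔ a * (v' - v) = a * j s := (Units.mul_right_inj a).symm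
      have h₂ : v' - v = -(j s : ZMod n) ↔ a * (v' - v) = -(a * j s) := by
        rw [← mul_neg, Units.mul_right_inj]
      rw [h₁, h₂]
      rcases hσ s with h | h <;> rw [h]
      rw [neg_neg, or_comm]
    rw [GI_adj_iff hj, GI_adj_iff hj]
    simp only [Equiv.prodCongr_apply, Prod.map_apply, Equiv.trans_apply, Units.mulLeft_apply,
      Equiv.coe_addRight, hd, key, add_left_inj, Units.mul_right_inj, ne_eq,
      EmbeddingLike.apply_eq_iff_eq]

theorem RespectsPart.snd_apply_eq {n t : ℕ} {j : Fin t → ℤ} (hj : ∀ s, (j s : ZMod n) ≠ 0)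
    {f : Fin t × ZMod n → Fin t × ZMod n} (hf : RespectsPart n t j f) (s s' : Fin t)
    (v : ZMod n) : (f (s, v)).2 = (f (s', v)).2 := by
  rcases eq_or_ne s s' with rfl | h
  · rfl
  · exact hf.1 _ _ ((GI_adj_iff hj _ _).2 (.inl ⟨rfl, h⟩)) rfl

theorem GI_adj_add {n t : ℕ} {j : Fin t → ℤ} (hj : ∀ s, (j s : ZMod n) ≠ 0) (s : Fin t)
    (v : ZMod n) : (GI n t j).Adj (s, v) (s, v + j s) :=
  (GI_adj_iff hj _ _).2 (.inr ⟨rfl, .inl (add_sub_cancel_left _ _)⟩)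

/-- An automorphism respecting the edge-partition moves layer edges by layer edges. -/
theorem RespectsPart.sub_eq_or_neg {n t : ℕ} {j : Fin t → ℤ} (hj : ∀ s, (j s : ZMod n) ≠ 0)
    {φ : GI n t j ≃g GI n t j} (hφ : RespectsPart n t j φ) (s : Fin t) (v : ZMod n) :
    (φ (s, v + j s)).2 - (φ (s, v)).2 = j (φ (s, v)).1 ∨
      (φ (s, v + j s)).2 - (φ (s, v)).2 = -(j (φ (s, v)).1 : ZMod n) := by
  have hadj := GI_adj_add hj s v
  have hfst := hφ.2 _ _ hadj rfl
  rcases (GI_adj_iff hj _ _).1 (φ.map_adj_iff.2 hadj) with h | h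
  · exact absurd hfst h.2
  · exact h.2

theorem RespectsPart.affineAlong {n t : ℕ} {j : Fin t → ℤ} (hj : ∀ s, (j s : ZMod n) ≠ 0)
    (hj2 : ∀ s, 2 • (j s : ZMod n) ≠ 0) {φ : GI n t j ≃g GI n t j}
    (hφ : RespectsPart n t j φ) (s₀ s : Fin t) :
    AffineAlong (fun v => (φ (s₀, v)).2) (j s : ZMod n) := by
  intro v
  have hfst : ∀ k : ℕ, (φ (s, v + k • (j s : ZMod n))).1 = (φ (s, v)).1 := by
    intro k
    induction k with
    | zero => simp
    | succ k ih =>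
      rw [← ih, succ_nsmul, ← add_assoc]
      exact (hφ.2 _ _ (GI_adj_add hj s _) rfl).symm
  have hlayer : ∀ w, (φ (s₀, w)).2 = (φ (s, w)).2 := hφ.snd_apply_eq hj s₀ s
  refine ⟨(φ (s, v + j s)).2 - (φ (s, v)).2, fun k => ?_⟩
  have h := eq_add_nsmul_of_sub_eq_or_neg (u := fun k => (φ (s, v + k • (j s : ZMod n))).2)
    (d := (j (φ (s, v)).1 : ZMod n)) (fun k => ?_) (fun k e => ?_) k
  · simpa [hlayer] using h
  · have := hφ.sub_eq_or_neg hj s (v + k • (j s : ZMod n))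
    rwa [hfst, add_assoc, ← succ_nsmul] at this
  · have := congrArg Prod.snd (φ.injective (Prod.ext ((hfst _).trans (hfst _).symm) e))
    simp only [add_nsmul, add_right_inj, add_eq_left] at this
    exact hj2 s this

/-- In a connected GI-graph the entries of `j` generate `ZMod n`. -/
theorem GI_nsmul_one_eq_zero_of_connected {n t : ℕ} {j : Fin t → ℤ}
    (hj : ∀ s, (j s : ZMod n) ≠ 0) (hconn : (GI n t j).Connected) (m : ℕ)
    (hm : ∀ s, m • (j s : ZMod n) = 0) : m • (1 : ZMod n) = 0 := by
  obtain ⟨s, -⟩ := hconn.nonempty.some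
  have key : ∀ x y, (GI n t j).Reachable x y → m • x.2 = m • y.2 := by
    rintro x y ⟨p⟩
    induction p with
    | nil => rfl
    | @cons x y z h p ih =>
      rw [← ih]
      rcases (GI_adj_iff hj _ _).1 h with ⟨h, -⟩ | ⟨-, h | h⟩
      · rw [h]
      · rw [sub_eq_iff_eq_add.1 h, nsmul_add, hm, zero_add]
      · rw [sub_eq_iff_eq_add.1 h, nsmul_add, smul_neg, hm, neg_zero, zero_add]
  simpa using key (s, 1) (s, 0) (hconn.preconnected _ _)

/-- An automorphism of a connected GI-graph that respects the edge-partition acts on the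
second coordinate by an affine map. -/
theorem RespectsPart.exists_snd_apply_eq {n t : ℕ} [NeZero n] {j : Fin t → ℤ}
    (hj : ∀ s, (j s : ZMod n) ≠ 0) (hj2 : ∀ s, 2 • (j s : ZMod n) ≠ 0)
    (hconn : (GI n t j).Connected) {φ : GI n t j ≃g GI n t j} (hφ : RespectsPart n t j φ) :
    ∃ (a : (ZMod n)ˣ) (b : ZMod n), ∀ s v, (φ (s, v)).2 = a * v + b := by
  obtain ⟨s₀, -⟩ := hconn.nonempty.some
  have haff : AffineAlong (fun v => (φ (s₀, v)).2) 1 :=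
    AffineAlong.one_of_generators (S := Set.range fun s => (j s : ZMod n))
      (by rintro _ ⟨s, rfl⟩; exact hφ.affineAlong hj hj2 s₀ s)
      (fun m hm => GI_nsmul_one_eq_zero_of_connected hj hconn m fun s => hm _ ⟨s, rfl⟩)
  obtain ⟨a, ha⟩ := haff 0
  have h : ∀ s v, (φ (s, v)).2 = a * v + (φ (s₀, 0)).2 := by
    intro s v
    rw [hφ.snd_apply_eq hj s s₀]
    have := ha v.val
    simp only [nsmul_eq_mul, mul_one, zero_add, ZMod.natCast_val, ZMod.cast_id', id] at this
    rw [this]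
    ring
  have hunit : IsUnit a := by
    obtain ⟨⟨s, v⟩, hv⟩ := φ.surjective (s₀, 1 + (φ (s₀, 0)).2)
    have := h s v
    rw [hv, add_left_inj] at this
    exact .of_mul_eq_one _ this.symm
  exact ⟨hunit.unit, _, h⟩

/-- Multiplication by a unit preserving `J ∪ -J` permutes the layers. -/
theorem exists_perm_of_image_JJset_eq {n t : ℕ} {j : Fin t → ℤ}
    (hpm : ∀ s s', ((j s : ZMod n) = j s' ∨ (j s : ZMod n) = -(j s' : ZMod n)) → s = s')
    (a : (ZMod n)ˣ) (ha : (fun x : ZMod n => (a : ZMod n) * x) '' JJset n j = JJset n j) :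
    ∃ σ : Equiv.Perm (Fin t), ∀ s, (a : ZMod n) * j s = j (σ s) ∨
      (a : ZMod n) * j s = -(j (σ s) : ZMod n) := by
  have h : ∀ s, ∃ s', (a : ZMod n) * j s = j s' ∨ (a : ZMod n) * j s = -(j s' : ZMod n) :=
    fun s => mem_JJset_iff.1
      (ha.subset (Set.mem_image_of_mem _ (mem_JJset_iff.2 ⟨s, .inl rfl⟩)))
  choose σ hσ using h
  have hinj : Function.Injective σ := by
    intro s s' e
    apply hpm
    rw [← Units.mul_right_inj a, ← Units.mul_right_inj (c := -(j s' : ZMod n)) a, mul_neg]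
    have h₁ := hσ s
    have h₂ := hσ s'
    rw [e] at h₁
    rcases h₁ with h₁ | h₁ <;> rcases h₂ with h₂ | h₂ <;> simp [h₁, h₂]
  exact ⟨.ofBijective σ (Finite.injective_iff_bijective.1 hinj), hσ⟩

theorem image_JJset_eq_of_forall {n t : ℕ} [NeZero n] {j : Fin t → ℤ} (a : (ZMod n)ˣ)
    (h : ∀ s, (a : ZMod n) * j s ∈ JJset n j) :
    (fun x : ZMod n => (a : ZMod n) * x) '' JJset n j = JJset n j := by
  have hneg : ∀ x ∈ JJset n j, -x ∈ JJset n j := by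
    intro x hx
    obtain ⟨s, rfl | rfl⟩ := mem_JJset_iff.1 hx
    · exact mem_JJset_iff.2 ⟨s, .inr rfl⟩
    · exact mem_JJset_iff.2 ⟨s, .inl (neg_neg _)⟩
  refine Set.eq_of_subset_of_ncard_le ?_ ?_ (Set.toFinite _)
  · rintro _ ⟨x, hx, rfl⟩
    obtain ⟨s, rfl | rfl⟩ := mem_JJset_iff.1 hx
    · exact h s
    · simpa only [mul_neg] using hneg _ (h s)
  · rw [Set.ncard_image_of_injective _ a.isUnit.mul_right_injective]

/-- if the `j s` are pairwise distinct with `0 < j s < n/2`, and `GI(n;j)`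
is connected with every automorphism respecting the fundamental edge-partition, then
the automorphism group has order `n·|A|` where
`A = {a ∈ (ZMod n)ˣ : a·(J ∪ -J) = J ∪ -J}`. -/
theorem GI_aut_card_set_case (n t : ℕ) (hn : 3 ≤ n) (ht : 1 ≤ t) (j : Fin t → ℤ)
    (hj : ∀ s, 0 < j s ∧ 2 * j s < (n : ℤ))
    (hinj : Function.Injective j)
    (hconn : (GI n t j).Connected)
    (hresp : ∀ φ : GI n t j ≃g GI n t j, RespectsPart n t j (fun x => φ x)) :
    Nat.card (GI n t j ≃g GI n t j) =
      n * Nat.card {a : (ZMod n)ˣ //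
        (fun x : ZMod n => (a : ZMod n) * x) '' JJset n j = JJset n j} := by
  have : NeZero n := ⟨by omega⟩
  have hpm : ∀ s s', ((j s : ZMod n) = j s' ∨ (j s : ZMod n) = -(j s' : ZMod n)) → s = s' := by
    rintro s s' (h | h) <;> have hs := hj s <;> have hs' := hj s'
    · exact hinj (intCast_zmod_injective_of_abs_lt (by rw [abs_lt]; omega) h)
    · rw [← Int.cast_neg] at h
      have := intCast_zmod_injective_of_abs_lt (by rw [abs_lt]; omega) h
      omega
  have hj0 : ∀ s, (j s : ZMod n) ≠ 0 := by
    intro s h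
    have hs := hj s
    rw [← Int.cast_zero] at h
    have := intCast_zmod_injective_of_abs_lt (by rw [abs_lt]; omega) h
    omega
  have hj2 : ∀ s, 2 • (j s : ZMod n) ≠ 0 := by
    intro s h
    have hs := hj s
    rw [← Int.cast_zero, two_nsmul, ← Int.cast_add] at h
    have := intCast_zmod_injective_of_abs_lt (by rw [abs_lt]; omega) h
    omega
  choose σ hσ using exists_perm_of_image_JJset_eq hpm
  let F : ZMod n × {a : (ZMod n)ˣ //
      (fun x : ZMod n => (a : ZMod n) * x) '' JJset n j = JJset n j} →
      (GI n t j ≃g GI n t j) :=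
    fun p => affineIso hj0 (σ p.2 p.2.2) p.2 p.1 (hσ p.2 p.2.2)
  have hF : ∀ p s v, F p (s, v) = (σ p.2 p.2.2 s, (p.2.1 : ZMod n) * v + p.1) := fun _ _ _ => rfl
  have hbij : Function.Bijective F := by
    constructor
    · intro p q e
      have h : ∀ v, (p.2.1 : ZMod n) * v + p.1 = q.2.1 * v + q.1 := fun v =>
        congrArg Prod.snd (DFunLike.congr_fun e ((⟨0, ht⟩ : Fin t), v))
      have hb : p.1 = q.1 := by simpa using h 0
      have ha : (p.2.1 : ZMod n) = q.2.1 := by simpa [hb] using h 1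
      exact Prod.ext hb (Subtype.ext (Units.ext ha))
    · intro φ
      obtain ⟨a, b, hab⟩ := RespectsPart.exists_snd_apply_eq hj0 hj2 hconn (hresp φ)
      have hstep : ∀ s v, (a : ZMod n) * j s = j (φ (s, v)).1 ∨
          (a : ZMod n) * j s = -(j (φ (s, v)).1 : ZMod n) := by
        intro s v
        have h := RespectsPart.sub_eq_or_neg hj0 (hresp φ) s v
        rwa [hab, hab, show (a : ZMod n) * (v + j s) + b - (a * v + b) = a * j s by ring] at h
      have ha := image_JJset_eq_of_forall a fun s => mem_JJset_iff.2 ⟨_, hstep s 0⟩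
      refine ⟨(b, ⟨a, ha⟩), RelIso.ext ?_⟩
      rintro ⟨s, v⟩
      rw [hF]
      refine Prod.ext (hpm _ _ ?_) (hab s v).symm
      have h₁ := hσ a ha s
      have h₂ := hstep s v
      rcases h₁ with h₁ | h₁ <;> rcases h₂ with h₂ | h₂ <;> rw [h₁] at h₂
      · exact .inl h₂
      · exact .inr h₂
      · exact .inr (neg_eq_iff_eq_neg.1 h₂)
      · exact .inl (neg_inj.1 h₂)
  rw [← Nat.card_congr (Equiv.ofBijective F hbij), Nat.card_prod, Nat.card_zmod]
end
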